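/- arXiv:1806.07145 — 3 statements merged into one kernel-verified Lean document; each statement's English description precedes it below -/
import Mathlib

section
/- Let (v,p) be a smooth axisymmetric solution of the Navier–Stokes equations on ℝ³×(0,T) with viscosity ν>0 satisfying the energy inequality ∫_{ℝ³}|v(t)|² dx + ν∫₀^t∫_{ℝ³}(|∇v|² + |v_r/r|² + |v_φ/r|²) dx dt' ≤ c‖v(0)‖²_{L₂(ℝ³)} and the swirl maximum principle ‖r v_φ‖_{L_∞(ℝ³×(0,T))} ≤ ‖u(0)‖_{L_∞(ℝ³)} with u(0)=r v_φ(0). Then for all t ≤ T: ∫₀^t ∫_{ℝ³} |v_φ|⁴ dx dt' ≤ c ‖u(0)‖²_{L_∞(ℝ³)} ‖v(0)‖²_{L₂(ℝ³)}. -/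
open MeasureTheory Real Set ENNReal

noncomputable section

/-- Radial cylindrical coordinate of a point in `ℝ³`. -/
def rad (x : Fin 3 → ℝ) : ℝ := Real.sqrt ((x 0) ^ 2 + (x 1) ^ 2)

/-- `∂_r` of a function of the cylindrical variables `(r, z, t)`. -/
def pdr (f : ℝ → ℝ → ℝ → ℝ) : ℝ → ℝ → ℝ → ℝ := fun r z t => deriv (fun s => f s z t) r

/-- `∂_z` of a function of the cylindrical variables `(r, z, t)`. -/
def pdz (f : ℝ → ℝ → ℝ → ℝ) : ℝ → ℝ → ℝ → ℝ := fun r z t => deriv (fun s => f r s t) z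

/-- `∂_t` of a function of the cylindrical variables `(r, z, t)`. -/
def pdt (f : ℝ → ℝ → ℝ → ℝ) : ℝ → ℝ → ℝ → ℝ := fun r z t => deriv (fun s => f r z s) t

/-- Axisymmetric Laplacian `Δ = ∂_r² + ∂_z² + (1/r)∂_r`. -/
def cylLap (f : ℝ → ℝ → ℝ → ℝ) : ℝ → ℝ → ℝ → ℝ :=
  fun r z t => pdr (pdr f) r z t + pdz (pdz f) r z t + (1 / r) * pdr f r z t

/-- Smoothness of a cylindrical-coordinate function away from the axis `r = 0`. -/
def SmoothCyl (f : ℝ → ℝ → ℝ → ℝ) : Prop :=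
  ContDiffOn ℝ (⊤ : ℕ∞) (fun q : ℝ × ℝ × ℝ => f q.1 q.2.1 q.2.2) {q : ℝ × ℝ × ℝ | 0 < q.1}

/-- Sufficiently fast decay at spatial infinity together with vanishing near the
symmetry axis (uniformly in time), modelled by compact support away from the axis. -/
def SuppAway (f : ℝ → ℝ → ℝ → ℝ) : Prop :=
  ∃ δ R : ℝ, 0 < δ ∧ ∀ r z t : ℝ, (r ≤ δ ∨ R ≤ r ∨ R ≤ |z|) → f r z t = 0

/-- Integral over `ℝ³` of a nonnegative axisymmetric integrand given in
cylindrical coordinates `(r, z)`. -/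
def spIntegral (g : ℝ → ℝ → ℝ) : ℝ≥0∞ :=
  ∫⁻ x : Fin 3 → ℝ, ENNReal.ofReal (g (rad x) (x 2))

/-- Integral over `ℝ³ × (0, t)` of a nonnegative axisymmetric integrand given in
cylindrical coordinates `(r, z)` and time. -/
def stIntegral (t : ℝ) (g : ℝ → ℝ → ℝ → ℝ) : ℝ≥0∞ :=
  ∫⁻ τ in Set.Ioo 0 t, ∫⁻ x : Fin 3 → ℝ, ENNReal.ofReal (g (rad x) (x 2) τ)

/-- The axially symmetric Navier–Stokes system in cylindrical components: with
`v·∇ = v_r ∂_r + v_z ∂_z`,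
`v_{r,t} + v·∇v_r − v_φ²/r − νΔv_r + ν v_r/r² = −p_{,r}`,
`v_{φ,t} + v·∇v_φ + (v_r/r) v_φ − νΔv_φ + ν v_φ/r² = 0`,
`v_{z,t} + v·∇v_z − νΔv_z = −p_{,z}`,
`v_{r,r} + v_{z,z} = −v_r/r`,
for `r > 0` and `t ∈ (0, T)`. -/
def IsAxisymNS (ν T : ℝ) (vr vφ vz p : ℝ → ℝ → ℝ → ℝ) : Prop :=
  ∀ r z t : ℝ, 0 < r → t ∈ Set.Ioo 0 T →
    (pdt vr r z t + vr r z t * pdr vr r z t + vz r z t * pdz vr r z t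
        - (vφ r z t) ^ 2 / r - ν * cylLap vr r z t + ν * vr r z t / r ^ 2
        = - pdr p r z t) ∧
    (pdt vφ r z t + vr r z t * pdr vφ r z t + vz r z t * pdz vφ r z t
        + vr r z t / r * vφ r z t - ν * cylLap vφ r z t + ν * vφ r z t / r ^ 2 = 0) ∧
    (pdt vz r z t + vr r z t * pdr vz r z t + vz r z t * pdz vz r z t
        - ν * cylLap vz r z t = - pdz p r z t) ∧
    (pdr vr r z t + pdz vz r z t = - vr r z t / r)

/-- The symmetry axis is a null set: almost every point has positive radial coordinate. -/
theorem ae_rad_pos : ∀ᵐ x : Fin 3 → ℝ, 0 < rad x := by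
  filter_upwards [Measure.ae_eval_ne (μ := fun _ : Fin 3 => (volume : Measure ℝ)) 0 0] with x hx
  have h_sq : 0 < (x 0) ^ 2 := by positivity
  exact Real.sqrt_pos.mpr (by positivity)

/-- Comparison of space-time integrals, up to a constant factor, of integrands compared off the
axis. -/
theorem stIntegral_le_mul {t a : ℝ} (ha : 0 ≤ a) {f g : ℝ → ℝ → ℝ → ℝ}
    (hfg : ∀ r z τ : ℝ, 0 < r → τ ∈ Set.Ioo 0 t → f r z τ ≤ a * g r z τ) :
    stIntegral t f ≤ ENNReal.ofReal a * stIntegral t g := by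
  unfold stIntegral
  rw [← lintegral_const_mul' _ _ ENNReal.ofReal_ne_top]
  refine setLIntegral_mono' measurableSet_Ioo fun τ hτ => ?_
  rw [← lintegral_const_mul' _ _ ENNReal.ofReal_ne_top]
  refine lintegral_mono_ae ?_
  filter_upwards [ae_rad_pos] with x hx
  rw [← ENNReal.ofReal_mul ha]
  exact ENNReal.ofReal_le_ofReal (hfg _ _ _ hx hτ)

/-- A bound on the swirl `r v` controls `v ^ 4` by `(v / r) ^ 2`. -/
theorem pow_four_le_of_abs_mul_le {r v K : ℝ} (hr : 0 < r) (h : |r * v| ≤ K) :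
    v ^ 4 ≤ K ^ 2 * (v / r) ^ 2 := by
  have h_eq : v ^ 4 = (r * v) ^ 2 * (v / r) ^ 2 := by field_simp
  rw [h_eq]
  exact mul_le_mul_of_nonneg_right (sq_le_sq' (abs_le.mp h).1 (abs_le.mp h).2) (sq_nonneg _)

/-- **Remark 2.5**: from the energy inequality and the swirl maximum principle one gets
`∫₀ᵗ∫ |v_φ|⁴ dx dt' ≤ C ‖u(0)‖²_{L_∞} ‖v(0)‖²_{L₂}`, with `C` depending only on the energy
constant `c` and the viscosity `ν`. -/
theorem vphi_L4_bound (c ν : ℝ) (hc : 0 ≤ c) (hν : 0 < ν) :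
    ∃ C : ℝ, 0 < C ∧
      ∀ (T K : ℝ) (vr vφ vz p : ℝ → ℝ → ℝ → ℝ),
        0 < T → 0 ≤ K →
        SmoothCyl vr → SmoothCyl vφ → SmoothCyl vz →
        IsAxisymNS ν T vr vφ vz p →
        -- the energy inequality
        (∀ t ∈ Set.Icc 0 T,
          spIntegral (fun r z => (vr r z t) ^ 2 + (vφ r z t) ^ 2 + (vz r z t) ^ 2)
            + ENNReal.ofReal ν * stIntegral t (fun r z τ =>
                (pdr vr r z τ) ^ 2 + (pdz vr r z τ) ^ 2
                + (pdr vφ r z τ) ^ 2 + (pdz vφ r z τ) ^ 2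
                + (pdr vz r z τ) ^ 2 + (pdz vz r z τ) ^ 2
                + (vr r z τ / r) ^ 2 + (vφ r z τ / r) ^ 2)
          ≤ ENNReal.ofReal c *
              spIntegral (fun r z => (vr r z 0) ^ 2 + (vφ r z 0) ^ 2 + (vz r z 0) ^ 2)) →
        -- the swirl maximum principle `‖r v_φ‖_{L_∞(ℝ³×(0,T))} ≤ ‖u(0)‖_{L_∞(ℝ³)} ≤ K`
        (∀ r z : ℝ, 0 < r → |r * vφ r z 0| ≤ K) →
        (∀ r z t : ℝ, 0 < r → t ∈ Set.Icc 0 T → |r * vφ r z t| ≤ K) →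
        ∀ t ∈ Set.Icc 0 T,
          stIntegral t (fun r z τ => (vφ r z τ) ^ 4)
            ≤ ENNReal.ofReal (C * K ^ 2) *
                spIntegral (fun r z => (vr r z 0) ^ 2 + (vφ r z 0) ^ 2 + (vz r z 0) ^ 2) := by
  refine ⟨c / ν + 1, by positivity, ?_⟩
  intro T K vr vφ vz p _ _ _ _ _ _ hE _ hK t ht
  have h_energy := le_trans le_add_self (hE t ht)
  set E := spIntegral (fun r z => (vr r z 0) ^ 2 + (vφ r z 0) ^ 2 + (vz r z 0) ^ 2)
  set S := stIntegral t (fun r z τ =>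
    (pdr vr r z τ) ^ 2 + (pdz vr r z τ) ^ 2
    + (pdr vφ r z τ) ^ 2 + (pdz vφ r z τ) ^ 2
    + (pdr vz r z τ) ^ 2 + (pdz vz r z τ) ^ 2
    + (vr r z τ / r) ^ 2 + (vφ r z τ / r) ^ 2)
  have hS : stIntegral t (fun r z τ => (vφ r z τ) ^ 4) ≤ ENNReal.ofReal (K ^ 2) * S := by
    refine stIntegral_le_mul (sq_nonneg K) fun r z τ hr hτ => ?_
    refine (pow_four_le_of_abs_mul_le hr (hK r z τ hr ⟨hτ.1.le, hτ.2.le.trans ht.2⟩)).trans ?_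
    refine mul_le_mul_of_nonneg_left (le_add_of_nonneg_left ?_) (sq_nonneg K)
    positivity
  calc stIntegral t (fun r z τ => (vφ r z τ) ^ 4)
      ≤ ENNReal.ofReal (K ^ 2) * S := hS
    _ = ENNReal.ofReal (K ^ 2 / ν) * (ENNReal.ofReal ν * S) := by
        rw [← mul_assoc, ← ENNReal.ofReal_mul (by positivity), div_mul_cancel₀ _ hν.ne']
    _ ≤ ENNReal.ofReal (K ^ 2 / ν) * (ENNReal.ofReal c * E) := mul_le_mul_right h_energy _
    _ = ENNReal.ofReal (K ^ 2 / ν * c) * E := by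
        rw [← mul_assoc, ← ENNReal.ofReal_mul (by positivity)]
    _ ≤ ENNReal.ofReal ((c / ν + 1) * K ^ 2) * E := by
        refine mul_le_mul_left (ENNReal.ofReal_le_ofReal ?_) _
        have h_eq : (c / ν + 1) * K ^ 2 = K ^ 2 / ν * c + K ^ 2 := by ring
        rw [h_eq]
        exact le_add_of_nonneg_right (sq_nonneg K)
end
end

section
/- Let ε > 0, α ∈ (0,1], and let ψ be a smooth function on ℝ³_ε = {x ∈ ℝ³ : r > ε}, depending only on (r,z), vanishing at r = ε and decaying at infinity, such that u = ψ_{,z} satisfies −∆u + u/r² = f_{,z} on ℝ³_ε for a smooth function f = f(r,z) decaying at infinity. Then there is a constant c depending only on α such that ∫_{ℝ³_ε} r^{−α} |∇ψ_{,z}|² dx + (1 − α²/2) ∫_{ℝ³_ε} ψ_{,z}² / r^{2+α} dx ≤ c ∫_{ℝ³_ε} f² / r^α dx, where |∇w|² = w_{,r}² + w_{,z}² and dx = r dr dz dφ. -/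
open MeasureTheory Real Set ENNReal

noncomputable section

/-- `∂_r` of a function of the cylindrical variables `(r, z)`. -/
def pdr2 (f : ℝ → ℝ → ℝ) : ℝ → ℝ → ℝ := fun r z => deriv (fun s => f s z) r

/-- `∂_z` of a function of the cylindrical variables `(r, z)`. -/
def pdz2 (f : ℝ → ℝ → ℝ) : ℝ → ℝ → ℝ := fun r z => deriv (fun s => f r s) z

/-- Axisymmetric Laplacian `Δ = ∂_r² + ∂_z² + (1/r)∂_r` for functions of `(r, z)`. -/
def cylLap2 (f : ℝ → ℝ → ℝ) : ℝ → ℝ → ℝ :=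
  fun r z => pdr2 (pdr2 f) r z + pdz2 (pdz2 f) r z + (1 / r) * pdr2 f r z

/-- Decay at spatial infinity of a function of `(r, z)`. -/
def DecayAtInfinity2 (f : ℝ → ℝ → ℝ) : Prop :=
  ∀ ε : ℝ, 0 < ε → ∃ R : ℝ, ∀ r z : ℝ, R ≤ r ∨ R ≤ |z| → |f r z| ≤ ε

/-- Integral over `ℝ³_ε = {x ∈ ℝ³ : r > ε}` of a nonnegative axisymmetric integrand
given in cylindrical coordinates. -/
def spIntegralOn (ε : ℝ) (g : ℝ → ℝ → ℝ) : ℝ≥0∞ :=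
  ∫⁻ x in {x : Fin 3 → ℝ | ε < rad x}, ENNReal.ofReal (g (rad x) (x 2))

/-- The partial derivatives of a function smooth up to the boundary of a half plane are again
smooth up to the boundary. -/
lemma exists_partials_halfPlane {ε : ℝ} {g : ℝ × ℝ → ℝ}
    (hg : ContDiffOn ℝ (⊤ : ℕ∞) g {q : ℝ × ℝ | ε ≤ q.1}) :
    ∃ gr gz : ℝ × ℝ → ℝ,
      ContDiffOn ℝ (⊤ : ℕ∞) gr {q : ℝ × ℝ | ε ≤ q.1} ∧
      ContDiffOn ℝ (⊤ : ℕ∞) gz {q : ℝ × ℝ | ε ≤ q.1} ∧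
      (∀ q : ℝ × ℝ, ε < q.1 → HasFDerivAt g
        (gr q • ContinuousLinearMap.fst ℝ ℝ ℝ + gz q • ContinuousLinearMap.snd ℝ ℝ ℝ) q) ∧
      (∀ q : ℝ × ℝ, ε ≤ q.1 → HasDerivAt (fun s => g (q.1, s)) (gz q) q.2) := by
  set H : Set (ℝ × ℝ) := {q | ε ≤ q.1} with hH
  have hconv : Convex ℝ H := convex_halfSpace_ge (LinearMap.fst ℝ ℝ ℝ).isLinear ε
  have hopen : IsOpen {q : ℝ × ℝ | ε < q.1} := isOpen_lt continuous_const continuous_fst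
  have hsub : {q : ℝ × ℝ | ε < q.1} ⊆ H := fun q (hq : ε < q.1) => hq.le
  have hint : (interior H).Nonempty :=
    ⟨(ε + 1, 0), interior_maximal hsub hopen (show ε < ε + 1 by linarith)⟩
  have hU : UniqueDiffOn ℝ H := uniqueDiffOn_convex hconv hint
  have hD : ContDiffOn ℝ (⊤ : ℕ∞) (fderivWithin ℝ g H) H := hg.fderivWithin hU (by simp)
  have hdiff := hg.differentiableOn (by simp)
  refine ⟨fun q => fderivWithin ℝ g H q (1, 0), fun q => fderivWithin ℝ g H q (0, 1),
    hD.clm_apply contDiffOn_const, hD.clm_apply contDiffOn_const, fun q hq => ?_, fun q hq => ?_⟩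
  · have hn : H ∈ nhds q := Filter.mem_of_superset (hopen.mem_nhds hq) hsub
    have h := ((hdiff q hq.le).hasFDerivWithinAt).hasFDerivAt hn
    have hdec : (fderivWithin ℝ g H q (1, 0)) • ContinuousLinearMap.fst ℝ ℝ ℝ +
        (fderivWithin ℝ g H q (0, 1)) • ContinuousLinearMap.snd ℝ ℝ ℝ = fderivWithin ℝ g H q := by
      ext <;> simp
    simpa only [hdec] using h
  · have h := (hdiff q hq).hasFDerivWithinAt
    have hline : HasDerivWithinAt (fun s : ℝ => (q.1, s)) ((0 : ℝ), (1 : ℝ)) univ q.2 :=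
      ((hasDerivAt_const q.2 q.1).prodMk (hasDerivAt_id q.2)).hasDerivWithinAt
    have h' := HasFDerivWithinAt.comp_hasDerivWithinAt (t := H) q.2 h hline
      (fun s _ => by simpa [hH] using hq)
    simpa [hasDerivWithinAt_univ, Function.comp_def] using h'

/-- The energy identity obtained by testing `-Δu + u/r² = f_z` with `u a(r) b(z)` on a rectangle,
for weights vanishing to first order on the sides other than `r = r₀`. -/
lemma integral_weighted_energy_eq_zero {r₀ R : ℝ} (hr₀ : 0 < r₀) (hR : r₀ ≤ R)
    {u ur uz urr urz uzr uzz f fr fz : ℝ × ℝ → ℝ} {a a₁ a₂ b b₁ b₂ : ℝ → ℝ}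
    (hu : ContinuousOn u {q | r₀ ≤ q.1}) (hur : ContinuousOn ur {q | r₀ ≤ q.1})
    (huz : ContinuousOn uz {q | r₀ ≤ q.1}) (hf : ContinuousOn f {q | r₀ ≤ q.1})
    (ha : ContinuousOn a (Ici r₀)) (ha₁ : ContinuousOn a₁ (Ici r₀))
    (ha₂ : ContinuousOn a₂ (Ici r₀)) (hb : Continuous b) (hb₁ : Continuous b₁)
    (hb₂ : Continuous b₂)
    (hdu : ∀ q : ℝ × ℝ, r₀ < q.1 → HasFDerivAt u
      (ur q • ContinuousLinearMap.fst ℝ ℝ ℝ + uz q • ContinuousLinearMap.snd ℝ ℝ ℝ) q)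
    (hdur : ∀ q : ℝ × ℝ, r₀ < q.1 → HasFDerivAt ur
      (urr q • ContinuousLinearMap.fst ℝ ℝ ℝ + urz q • ContinuousLinearMap.snd ℝ ℝ ℝ) q)
    (hduz : ∀ q : ℝ × ℝ, r₀ < q.1 → HasFDerivAt uz
      (uzr q • ContinuousLinearMap.fst ℝ ℝ ℝ + uzz q • ContinuousLinearMap.snd ℝ ℝ ℝ) q)
    (hdf : ∀ q : ℝ × ℝ, r₀ < q.1 → HasFDerivAt f
      (fr q • ContinuousLinearMap.fst ℝ ℝ ℝ + fz q • ContinuousLinearMap.snd ℝ ℝ ℝ) q)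
    (hda : ∀ r, r₀ < r → HasDerivAt a (a₁ r) r) (hda₁ : ∀ r, r₀ < r → HasDerivAt a₁ (a₂ r) r)
    (hdb : ∀ z, HasDerivAt b (b₁ z) z) (hdb₁ : ∀ z, HasDerivAt b₁ (b₂ z) z)
    (hu0 : ∀ z, u (r₀, z) = 0) (haR : a R = 0) (haR₁ : a₁ R = 0)
    (hbR : b R = 0) (hbR₁ : b₁ R = 0) (hbR' : b (-R) = 0) (hbR₁' : b₁ (-R) = 0)
    (heq : ∀ q : ℝ × ℝ, r₀ < q.1 →
      -(urr q + uzz q + 1 / q.1 * ur q) + u q / q.1 ^ 2 = fz q) :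
    ∫ q in Icc (r₀, -R) (R, R), q.1 * (a q.1 * b q.2 * (ur q ^ 2 + uz q ^ 2)
      + u q ^ 2 * (a q.1 * b q.2) / q.1 ^ 2
      - 1 / 2 * u q ^ 2 * ((a₂ q.1 + a₁ q.1 / q.1) * b q.2 + a q.1 * b₂ q.2)
      + f q * uz q * (a q.1 * b q.2) + f q * u q * (a q.1 * b₁ q.2)) = 0 := by
  have hle : ((r₀, -R) : ℝ × ℝ) ≤ (R, R) := ⟨hR, by simp; linarith⟩
  have hsub : Icc ((r₀, -R) : ℝ × ℝ) (R, R) ⊆ {q | r₀ ≤ q.1} := fun q hq => hq.1.1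
  have hfst : MapsTo (Prod.fst : ℝ × ℝ → ℝ) (Icc ((r₀, -R) : ℝ × ℝ) (R, R)) (Ici r₀) :=
    fun q hq => hq.1.1
  have cu := hu.mono hsub
  have cur := hur.mono hsub
  have cuz := huz.mono hsub
  have cf := hf.mono hsub
  have ca := ha.comp continuousOn_fst hfst
  have ca₁ := ha₁.comp continuousOn_fst hfst
  have ca₂ := ha₂.comp continuousOn_fst hfst
  have cb : ContinuousOn (b ∘ Prod.snd) (Icc ((r₀, -R) : ℝ × ℝ) (R, R)) :=
    (hb.comp continuous_snd).continuousOn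
  have cb₁ : ContinuousOn (b₁ ∘ Prod.snd) (Icc ((r₀, -R) : ℝ × ℝ) (R, R)) :=
    (hb₁.comp continuous_snd).continuousOn
  have cb₂ : ContinuousOn (b₂ ∘ Prod.snd) (Icc ((r₀, -R) : ℝ × ℝ) (R, R)) :=
    (hb₂.comp continuous_snd).continuousOn
  have c1 : ContinuousOn (Prod.fst : ℝ × ℝ → ℝ) (Icc ((r₀, -R) : ℝ × ℝ) (R, R)) :=
    continuousOn_fst
  simp only [Function.comp_def] at ca ca₁ ca₂ cb cb₁ cb₂
  have hne : ∀ q ∈ Icc ((r₀, -R) : ℝ × ℝ) (R, R), q.1 ≠ 0 := fun q hq =>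
    (hr₀.trans_le hq.1.1).ne'
  have hne2 : ∀ q ∈ Icc ((r₀, -R) : ℝ × ℝ) (R, R), q.1 ^ 2 ≠ 0 := fun q hq =>
    pow_ne_zero 2 (hne q hq)
  set P : ℝ × ℝ → ℝ := fun q =>
    q.1 * ((a q.1 * b q.2) * (u q * ur q) - 1 / 2 * ((u q * u q) * (a₁ q.1 * b q.2))) with hP
  set Q : ℝ × ℝ → ℝ := fun q =>
    q.1 * (((a q.1 * b q.2) * (u q * uz q) - 1 / 2 * ((u q * u q) * (a q.1 * b₁ q.2)))
      + f q * (u q * (a q.1 * b q.2))) with hQ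
  set D : ℝ × ℝ → ℝ := fun q => q.1 * (a q.1 * b q.2 * (ur q ^ 2 + uz q ^ 2)
      + u q ^ 2 * (a q.1 * b q.2) / q.1 ^ 2
      - 1 / 2 * u q ^ 2 * ((a₂ q.1 + a₁ q.1 / q.1) * b q.2 + a q.1 * b₂ q.2)
      + f q * uz q * (a q.1 * b q.2) + f q * u q * (a q.1 * b₁ q.2)) with hD
  have hDc : ContinuousOn D (Icc ((r₀, -R) : ℝ × ℝ) (R, R)) := by
    have e1 := ((cu.pow 2).mul (ca.mul cb)).div (c1.pow 2) hne2
    have e2 := ca₁.div c1 hne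
    simp only [hD]
    fun_prop (disch := assumption)
  have hopen : ∀ q ∈ Ioo r₀ R ×ˢ Ioo (-R) R, ∃ P' Q' : ℝ × ℝ →L[ℝ] ℝ,
      HasFDerivAt P P' q ∧ HasFDerivAt Q Q' q ∧ P' (1, 0) + Q' (0, 1) = D q := by
    intro q hq
    have hq1 : r₀ < q.1 := hq.1.1
    have hq0 : q.1 ≠ 0 := (hr₀.trans hq1).ne'
    have du := hdu q hq1
    have dur := hdur q hq1
    have duz := hduz q hq1
    have df := hdf q hq1
    have d1 : HasFDerivAt Prod.fst (ContinuousLinearMap.fst ℝ ℝ ℝ) q := hasFDerivAt_fst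
    have d2 : HasFDerivAt Prod.snd (ContinuousLinearMap.snd ℝ ℝ ℝ) q := hasFDerivAt_snd
    have da := (hda q.1 hq1).comp_hasFDerivAt q d1
    have da₁ := (hda₁ q.1 hq1).comp_hasFDerivAt q d1
    have db := (hdb q.2).comp_hasFDerivAt q d2
    have db₁ := (hdb₁ q.2).comp_hasFDerivAt q d2
    refine ⟨_, _, d1.mul (((da.mul db).mul (du.mul dur)).sub
      (((du.mul du).mul (da₁.mul db)).const_mul (1 / 2))),
      d1.mul ((((da.mul db).mul (du.mul duz)).sub
      (((du.mul du).mul (da.mul db₁)).const_mul (1 / 2))).add (df.mul (du.mul (da.mul db)))), ?_⟩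
    simp only [hD, ← heq q hq1]
    simp
    field_simp
    ring
  choose! P' Q' hP' hQ' hPQ using hopen
  have hae : ∀ᵐ q : ℝ × ℝ, q ∈ Icc ((r₀, -R) : ℝ × ℝ) (R, R) →
      P' q (1, 0) + Q' q (0, 1) = D q := by
    have h := Measure.set_prod_ae_eq (μ := (volume : Measure ℝ)) (ν := (volume : Measure ℝ))
      (Ioo_ae_eq_Icc (a := r₀) (b := R)) (Ioo_ae_eq_Icc (a := -R) (b := R))
    rw [Icc_prod_Icc] at h
    filter_upwards [h.mem_iff] with q hq hq'
    exact hPQ q (hq.2 hq')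
  have hmeas : MeasurableSet (Icc ((r₀, -R) : ℝ × ℝ) (R, R)) := measurableSet_Icc
  have hDi : IntegrableOn D (Icc ((r₀, -R) : ℝ × ℝ) (R, R)) :=
    hDc.integrableOn_compact isCompact_Icc
  have key := integral_divergence_prod_Icc_of_hasFDerivAt_of_le P Q P' Q' (r₀, -R) (R, R) hle
    (by simp only [hP]; fun_prop) (by simp only [hQ]; fun_prop) hP' hQ'
    (hDi.congr ((ae_restrict_iff' hmeas).2 (by filter_upwards [hae] with q hq h using (hq h).symm)))
  rw [setIntegral_congr_ae hmeas hae] at key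
  rw [key]
  simp [hP, hQ, hu0, haR, haR₁, hbR, hbR₁, hbR', hbR₁']
/-- Derivatives of the weight `r ^ (-α) * (ρ + r) ^ (-(5/4 - α))`, which behaves like `r ^ (-α)`
for `r ≪ ρ` and like `r ^ (-5/4)` for `r ≫ ρ`; the constant in the bound of its Laplacian is
less than `2`. -/
lemma exists_weight_derivs {α ρ : ℝ} (hα : α ∈ Ioc (0 : ℝ) 1) (hρ : 0 < ρ) :
    ∃ w₁ w₂ : ℝ → ℝ,
      (∀ r, 0 < r → HasDerivAt (fun r => r ^ (-α) * (ρ + r) ^ (-(5 / 4 - α))) (w₁ r) r) ∧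
      (∀ r, 0 < r → HasDerivAt w₁ (w₂ r) r) ∧ ContinuousOn w₂ (Ioi 0) ∧
      (∀ r, 0 < r → |w₁ r| ≤ 5 / 4 * (r ^ (-α) * (ρ + r) ^ (-(5 / 4 - α))) / r) ∧
      (∀ r, 0 < r → w₂ r + w₁ r / r ≤
        25 / 16 * (r ^ (-α) * (ρ + r) ^ (-(5 / 4 - α))) / r ^ 2) := by
  obtain ⟨hα0, hα1⟩ := hα
  set γ := 5 / 4 - α with hγ
  have hγ0 : 0 < γ := by linarith
  set w : ℝ → ℝ := fun r => r ^ (-α) * (ρ + r) ^ (-γ) with hw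
  have hwpos : ∀ r, 0 < r → 0 < w r := fun r hr => by positivity
  have hd : ∀ r, 0 < r → HasDerivAt w (-(w r * (α / r + γ / (ρ + r)))) r := by
    intro r hr
    have hs : 0 < ρ + r := by positivity
    have h1 := Real.hasDerivAt_rpow_const (x := r) (p := -α) (Or.inl hr.ne')
    have h2 := ((hasDerivAt_id r).const_add ρ).rpow_const (p := -γ) (Or.inl hs.ne')
    refine (h1.mul h2).congr_deriv ?_
    simp only [hw, id, Real.rpow_sub_one hr.ne', Real.rpow_sub_one hs.ne']
    field_simp
    ring
  have hq : ∀ r, 0 < r → HasDerivAt (fun r => α / r + γ / (ρ + r))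
      (-(α / r ^ 2 + γ / (ρ + r) ^ 2)) r := by
    intro r hr
    have hs : 0 < ρ + r := by positivity
    have h1 := (hasDerivAt_const r α).div (hasDerivAt_id r) hr.ne'
    have h2 := (hasDerivAt_const r γ).div ((hasDerivAt_id r).const_add ρ) hs.ne'
    refine (h1.add h2).congr_deriv ?_
    simp
    ring
  have hqle : ∀ r, 0 < r → 0 ≤ α / r + γ / (ρ + r) ∧ α / r + γ / (ρ + r) ≤ 5 / 4 / r := by
    intro r hr
    refine ⟨by positivity, ?_⟩
    have : γ / (ρ + r) ≤ γ / r := div_le_div_of_nonneg_left hγ0.le hr (by linarith)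
    calc α / r + γ / (ρ + r) ≤ α / r + γ / r := by linarith
      _ = 5 / 4 / r := by rw [hγ]; ring
  refine ⟨fun r => -(w r * (α / r + γ / (ρ + r))),
    fun r => -(-(w r * (α / r + γ / (ρ + r))) * (α / r + γ / (ρ + r))
      + w r * -(α / r ^ 2 + γ / (ρ + r) ^ 2)), hd,
    fun r hr => ((hd r hr).mul (hq r hr)).neg, ?_, fun r hr => ?_, fun r hr => ?_⟩
  · have hwc : ContinuousOn w (Ioi 0) := fun r hr => (hd r hr).continuousAt.continuousWithinAt
    have h0 : ∀ r ∈ Ioi (0 : ℝ), r ≠ 0 := fun r hr => (ne_of_gt hr)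
    have h1 : ∀ r ∈ Ioi (0 : ℝ), ρ + r ≠ 0 := fun r (hr : 0 < r) => by positivity
    have h2 : ∀ r ∈ Ioi (0 : ℝ), r ^ 2 ≠ 0 := fun r hr => pow_ne_zero 2 (h0 r hr)
    have h3 : ∀ r ∈ Ioi (0 : ℝ), (ρ + r) ^ 2 ≠ 0 := fun r hr => pow_ne_zero 2 (h1 r hr)
    fun_prop (disch := assumption)
  · obtain ⟨h0, h1⟩ := hqle r hr
    rw [abs_neg, abs_of_nonneg (mul_nonneg (hwpos r hr).le h0)]
    calc w r * (α / r + γ / (ρ + r)) ≤ w r * (5 / 4 / r) := by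
          gcongr
      _ = _ := by ring
  · obtain ⟨h0, h1⟩ := hqle r hr
    have hs : 0 < ρ + r := by positivity
    have h2 : γ / (ρ + r) ^ 2 ≤ γ / (ρ + r) / r := by
      rw [div_div]
      gcongr
      nlinarith
    have h3 : (α / r + γ / (ρ + r)) ^ 2 ≤ (5 / 4 / r) ^ 2 := by gcongr
    have h4 := mul_le_mul_of_nonneg_left h3 (hwpos r hr).le
    have h5 := mul_le_mul_of_nonneg_left h2 (hwpos r hr).le
    calc _ = w r * (α / r + γ / (ρ + r)) ^ 2 + w r * (γ / (ρ + r) ^ 2)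
          - w r * (γ / (ρ + r) / r) := by field_simp; ring
      _ ≤ w r * (5 / 4 / r) ^ 2 := by linarith
      _ = _ := by field_simp; ring

/-- Pointwise lower bound for the integrand of the energy identity, for a weight `w`
multiplied by cutoffs `X` in `r` and `Y` in `z`. -/
lemma weighted_energy_density_le {r R M u ur uz f w w₁ w₂ X X₁ X₂ Y Y₁ Y₂ : ℝ}
    (hr : 0 < r) (hu : |u| ≤ M) (hw : 0 ≤ w)
    (hw₂ : w₂ + w₁ / r ≤ 25 / 16 * w / r ^ 2)
    (hX : 0 ≤ X) (hX' : X ≤ 1) (hY : 0 ≤ Y) (hY' : Y ≤ 1)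
    (hX₂ : 2 * w₁ * X₁ + w * (X₂ + X₁ / r) ≤ 18 * w / R ^ 2)
    (hY₁ : Y₁ ^ 2 ≤ 16 / R ^ 2) (hY₂ : Y₂ ≤ 8 / R ^ 2) :
    r * (w * X * Y * (1 / 2 * (ur ^ 2 + uz ^ 2) + 7 / 32 * u ^ 2 / r ^ 2)) ≤
      r * (w * X * Y * (ur ^ 2 + uz ^ 2) + u ^ 2 * (w * X * Y) / r ^ 2
      - 1 / 2 * u ^ 2 * (((w₂ * X + 2 * w₁ * X₁ + w * X₂) + (w₁ * X + w * X₁) / r) * Y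
        + w * X * Y₂)
      + f * uz * (w * X * Y) + f * u * (w * X * Y₁))
      + (r * w * f ^ 2 + 21 * M ^ 2 / R ^ 2 * (r * w)) := by
  have hM : u ^ 2 ≤ M ^ 2 := sq_le_sq' (neg_le_of_abs_le hu) (le_of_abs_le hu)
  have hXY : X * Y ≤ 1 := mul_le_one₀ hX' hY hY'
  have hXY0 : 0 ≤ X * Y := mul_nonneg hX hY
  have hlap : ((w₂ * X + 2 * w₁ * X₁ + w * X₂) + (w₁ * X + w * X₁) / r) * Y + w * X * Y₂ ≤
      X * Y * (25 / 16 * w / r ^ 2) + 26 * w / R ^ 2 := by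
    have h1 := mul_le_mul_of_nonneg_left hw₂ hXY0
    have h2 : Y * (2 * w₁ * X₁ + w * (X₂ + X₁ / r)) ≤ 18 * w / R ^ 2 :=
      (mul_le_mul_of_nonneg_left hX₂ hY).trans (mul_le_of_le_one_left (by positivity) hY')
    have h3 : w * X * Y₂ ≤ 8 * w / R ^ 2 := by
      calc w * X * Y₂ ≤ w * X * (8 / R ^ 2) := by gcongr
        _ = X * (8 * w / R ^ 2) := by ring
        _ ≤ _ := mul_le_of_le_one_left (by positivity) hX'
    calc _ = X * Y * (w₂ + w₁ / r) + Y * (2 * w₁ * X₁ + w * (X₂ + X₁ / r)) + w * X * Y₂ := by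
          ring
      _ ≤ X * Y * (25 / 16 * w / r ^ 2) + 18 * w / R ^ 2 + 8 * w / R ^ 2 := by linarith
      _ = _ := by ring
  have hlap' := mul_le_mul_of_nonneg_left hlap (show 0 ≤ 1 / 2 * u ^ 2 by positivity)
  have hMw : u ^ 2 * (w / R ^ 2) ≤ M ^ 2 * (w / R ^ 2) := by gcongr
  have hfz : -(1 / 2 * (w * X * Y) * uz ^ 2) - 1 / 2 * w * f ^ 2 ≤ f * uz * (w * X * Y) := by
    have h1 : 0 ≤ w * X * Y * (f + uz) ^ 2 := by positivity
    have h2 : X * Y * (w * f ^ 2) ≤ w * f ^ 2 := mul_le_of_le_one_left (by positivity) hXY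
    nlinarith
  have hfu : -(1 / 2 * w * f ^ 2) - 8 * u ^ 2 * (w / R ^ 2) ≤ f * u * (w * X * Y₁) := by
    have h1 : 0 ≤ w * (f + u * (X * Y₁)) ^ 2 := by positivity
    have h2 : (X * Y₁) ^ 2 ≤ 16 / R ^ 2 := by
      rw [mul_pow]
      exact (mul_le_of_le_one_left (sq_nonneg _) (pow_le_one₀ hX hX')).trans hY₁
    have h3 := mul_le_mul_of_nonneg_left h2 (show 0 ≤ w * u ^ 2 by positivity)
    have h4 : w * u ^ 2 * (16 / R ^ 2) = 16 * u ^ 2 * (w / R ^ 2) := by ring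
    nlinarith
  have hpos : 0 ≤ 1 / 2 * (w * X * Y) * ur ^ 2 := by positivity
  have e1 : 1 / 2 * u ^ 2 * (X * Y * (25 / 16 * w / r ^ 2) + 26 * w / R ^ 2) =
      25 / 32 * (u ^ 2 * (w * X * Y) / r ^ 2) + 13 * (u ^ 2 * (w / R ^ 2)) := by ring
  have e2 : w * X * Y * (1 / 2 * (ur ^ 2 + uz ^ 2) + 7 / 32 * u ^ 2 / r ^ 2) =
      1 / 2 * (w * X * Y) * ur ^ 2 + 1 / 2 * (w * X * Y) * uz ^ 2
        + 7 / 32 * (u ^ 2 * (w * X * Y) / r ^ 2) := by ring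
  have e3 : r * w * f ^ 2 + 21 * M ^ 2 / R ^ 2 * (r * w) =
      r * (w * f ^ 2 + 21 * (M ^ 2 * (w / R ^ 2))) := by ring
  rw [e3, ← mul_add, e2]
  refine mul_le_mul_of_nonneg_left ?_ hr.le
  rw [e1] at hlap'
  linarith

/-- Derivatives of the cutoff `(1 - s² / R²)²`. -/
lemma hasDerivAt_quarticCutoff (R s : ℝ) :
    HasDerivAt (fun s => (1 - s ^ 2 / R ^ 2) ^ 2) (-(4 * s / R ^ 2) * (1 - s ^ 2 / R ^ 2)) s ∧
    HasDerivAt (fun s => -(4 * s / R ^ 2) * (1 - s ^ 2 / R ^ 2))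
      (-(4 / R ^ 2) + 12 * s ^ 2 / R ^ 4) s := by
  have h0 : HasDerivAt (fun s : ℝ => 1 - s ^ 2 / R ^ 2) (-(2 * s / R ^ 2)) s := by
    simpa using ((hasDerivAt_pow 2 s).div_const (R ^ 2)).const_sub 1
  have h1 : HasDerivAt (fun s : ℝ => -(4 * s / R ^ 2)) (-(4 / R ^ 2)) s := by
    simpa using (((hasDerivAt_id s).const_mul 4).div_const (R ^ 2)).fun_neg
  refine ⟨(h0.pow 2).congr_deriv (by simp; ring), (h1.mul h0).congr_deriv ?_⟩
  by_cases hR : R = 0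
  · simp [hR]
  · field_simp
    ring

/-- The weight `r ^ (-α) * (ρ + r) ^ (-(5/4 - α))`, a regularization of `r ^ (-α)` with faster
decay at infinity. -/
def streamWeight (α ρ r : ℝ) : ℝ := r ^ (-α) * (ρ + r) ^ (-(5 / 4 - α))

/-- The cutoff `(1 - s² / R²)²`, vanishing to first order at `s = ±R`. -/
def quarticCutoff (R s : ℝ) : ℝ := (1 - s ^ 2 / R ^ 2) ^ 2

/-- `u` is continuously differentiable up to `r = r₀`, with partial derivatives `ur`, `uz`,
vanishes at `r = r₀` and solves `-Δu + u / r² = f_z` for `r > r₀`. -/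
structure IsStreamSolution (r₀ : ℝ) (u ur uz f : ℝ × ℝ → ℝ) : Prop where
  continuousOn : ContinuousOn u {q | r₀ ≤ q.1}
  continuousOn_r : ContinuousOn ur {q | r₀ ≤ q.1}
  continuousOn_z : ContinuousOn uz {q | r₀ ≤ q.1}
  continuousOn_source : ContinuousOn f {q | r₀ ≤ q.1}
  boundary : ∀ z, u (r₀, z) = 0
  equation : ∃ urr urz uzr uzz fr fz : ℝ × ℝ → ℝ, ∀ q : ℝ × ℝ, r₀ < q.1 →
    HasFDerivAt u
      (ur q • ContinuousLinearMap.fst ℝ ℝ ℝ + uz q • ContinuousLinearMap.snd ℝ ℝ ℝ) q ∧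
    HasFDerivAt ur
      (urr q • ContinuousLinearMap.fst ℝ ℝ ℝ + urz q • ContinuousLinearMap.snd ℝ ℝ ℝ) q ∧
    HasFDerivAt uz
      (uzr q • ContinuousLinearMap.fst ℝ ℝ ℝ + uzz q • ContinuousLinearMap.snd ℝ ℝ ℝ) q ∧
    HasFDerivAt f
      (fr q • ContinuousLinearMap.fst ℝ ℝ ℝ + fz q • ContinuousLinearMap.snd ℝ ℝ ℝ) q ∧
    -(urr q + uzz q + 1 / q.1 * ur q) + u q / q.1 ^ 2 = fz q

/-- The energy density controlled by the weighted estimate. -/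
def streamEnergy (u ur uz : ℝ × ℝ → ℝ) (q : ℝ × ℝ) : ℝ :=
  1 / 2 * (ur q ^ 2 + uz q ^ 2) + 7 / 32 * u q ^ 2 / q.1 ^ 2

lemma streamEnergy_nonneg (u ur uz : ℝ × ℝ → ℝ) (q : ℝ × ℝ) : 0 ≤ streamEnergy u ur uz q := by
  unfold streamEnergy
  positivity

lemma IsStreamSolution.continuousOn_streamEnergy {r₀ : ℝ} {u ur uz f : ℝ × ℝ → ℝ} (hr₀ : 0 < r₀)
    (h : IsStreamSolution r₀ u ur uz f) :
    ContinuousOn (streamEnergy u ur uz) {q | r₀ ≤ q.1} := by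
  have h1 := h.continuousOn
  have h2 := h.continuousOn_r
  have h3 := h.continuousOn_z
  have h0 : ∀ q ∈ {q : ℝ × ℝ | r₀ ≤ q.1}, q.1 ^ 2 ≠ 0 := fun q hq =>
    pow_ne_zero 2 (hr₀.trans_le hq).ne'
  unfold streamEnergy
  fun_prop (disch := assumption)

lemma streamWeight_pos {α ρ r : ℝ} (hρ : 0 < ρ) (hr : 0 < r) : 0 < streamWeight α ρ r := by
  unfold streamWeight
  positivity

lemma continuousOn_streamWeight {α ρ : ℝ} (hρ : 0 < ρ) :
    ContinuousOn (streamWeight α ρ) (Ioi 0) := by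
  intro r hr
  have hr : 0 < r := hr
  have h1 : ContinuousAt (fun r : ℝ => r ^ (-α)) r :=
    Real.continuousAt_rpow_const r (-α) (Or.inl hr.ne')
  have h2 : ContinuousAt (fun r : ℝ => (ρ + r) ^ (-(5 / 4 - α))) r :=
    (continuousAt_const.add continuousAt_id).rpow_const (Or.inl (add_pos hρ hr).ne')
  exact (h1.mul h2).continuousWithinAt

lemma sq_div_sq_le_one {R s : ℝ} (hR : 0 < R) (hs : |s| ≤ R) : s ^ 2 / R ^ 2 ≤ 1 := by
  rw [div_le_one (by positivity)]
  exact sq_le_sq' (neg_le_of_abs_le hs) (le_of_abs_le hs)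

/-- Weighted energy inequality on a rectangle, with an error that decays as the rectangle grows
for bounded `u`. -/
lemma IsStreamSolution.integral_weighted_le {α ρ r₀ R M : ℝ} {u ur uz f : ℝ × ℝ → ℝ}
    (h : IsStreamSolution r₀ u ur uz f) (hα : α ∈ Ioc (0 : ℝ) 1) (hρ : 0 < ρ) (hr₀ : 0 < r₀)
    (hR : r₀ < R) (hM : ∀ q : ℝ × ℝ, r₀ ≤ q.1 → |u q| ≤ M) :
    ∫ q in Icc (r₀, -R) (R, R), q.1 * (streamWeight α ρ q.1 * quarticCutoff R q.1 *
        quarticCutoff R q.2 * streamEnergy u ur uz q) ≤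
      ∫ q in Icc (r₀, -R) (R, R), (q.1 * streamWeight α ρ q.1 * f q ^ 2
        + 21 * M ^ 2 / R ^ 2 * (q.1 * streamWeight α ρ q.1)) := by
  obtain ⟨urr, urz, uzr, uzz, fr, fz, heq⟩ := h.equation
  obtain ⟨w₁, w₂, hw₁, hw₂, hw₂c, hw₁le, hlap⟩ := exists_weight_derivs hα hρ
  have hR0 : 0 < R := hr₀.trans hR
  set B : Set (ℝ × ℝ) := Icc (r₀, -R) (R, R) with hB
  set w : ℝ → ℝ := streamWeight α ρ with hw
  set X : ℝ → ℝ := fun s => (1 - s ^ 2 / R ^ 2) ^ 2 with hX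
  set X₁ : ℝ → ℝ := fun s => -(4 * s / R ^ 2) * (1 - s ^ 2 / R ^ 2) with hX₁
  set X₂ : ℝ → ℝ := fun s => -(4 / R ^ 2) + 12 * s ^ 2 / R ^ 4 with hX₂
  have hXd : ∀ s, HasDerivAt X (X₁ s) s := fun s => (hasDerivAt_quarticCutoff R s).1
  have hX₁d : ∀ s, HasDerivAt X₁ (X₂ s) s := fun s => (hasDerivAt_quarticCutoff R s).2
  have hXc : Continuous X := by simp only [hX]; fun_prop
  have hX₁c : Continuous X₁ := by simp only [hX₁]; fun_prop
  have hX₂c : Continuous X₂ := by simp only [hX₂]; fun_prop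
  have hIci : Ici r₀ ⊆ Ioi 0 := fun r hr => hr₀.trans_le hr
  have hwc : ContinuousOn w (Ici r₀) := (continuousOn_streamWeight hρ).mono hIci
  have hw₁c : ContinuousOn w₁ (Ici r₀) := fun r hr =>
    (hw₂ r (hIci hr)).continuousAt.continuousWithinAt
  replace hw₂c := hw₂c.mono hIci
  have hsub : B ⊆ {q | r₀ ≤ q.1} := fun q hq => hq.1.1
  have hfst : MapsTo (Prod.fst : ℝ × ℝ → ℝ) B (Ici r₀) := fun q hq => hq.1.1
  have h0 : ∀ q ∈ B, q.1 ≠ 0 := fun q hq => (hr₀.trans_le hq.1.1).ne'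
  have h0' : ∀ q ∈ B, q.1 ^ 2 ≠ 0 := fun q hq => pow_ne_zero 2 (h0 q hq)
  have cw : ContinuousOn (fun q : ℝ × ℝ => w q.1) B := hwc.comp continuousOn_fst hfst
  have cw₁ : ContinuousOn (fun q : ℝ × ℝ => w₁ q.1) B := hw₁c.comp continuousOn_fst hfst
  have cw₂ : ContinuousOn (fun q : ℝ × ℝ => w₂ q.1) B := hw₂c.comp continuousOn_fst hfst
  have cu := h.continuousOn.mono hsub
  have cur := h.continuousOn_r.mono hsub
  have cuz := h.continuousOn_z.mono hsub
  have cf := h.continuousOn_source.mono hsub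
  have ce := (h.continuousOn_streamEnergy hr₀).mono hsub
  have hzero := integral_weighted_energy_eq_zero (a := fun r => w r * X r)
    (a₁ := fun r => w₁ r * X r + w r * X₁ r)
    (a₂ := fun r => w₂ r * X r + 2 * w₁ r * X₁ r + w r * X₂ r) (b := X) (b₁ := X₁) (b₂ := X₂)
    hr₀ hR.le h.continuousOn h.continuousOn_r h.continuousOn_z h.continuousOn_source
    (by fun_prop) (by fun_prop) (by fun_prop) hXc hX₁c hX₂c
    (fun q hq => (heq q hq).1) (fun q hq => (heq q hq).2.1) (fun q hq => (heq q hq).2.2.1)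
    (fun q hq => (heq q hq).2.2.2.1) (fun r hr => (hw₁ r (hr₀.trans hr)).mul (hXd r))
    (fun r hr => (((hw₂ r (hr₀.trans hr)).mul (hXd r)).add
      ((hw₁ r (hr₀.trans hr)).mul (hX₁d r))).congr_deriv (by simp only [hw, streamWeight]; ring))
    hXd hX₁d h.boundary (by simp [hX, hR0.ne']) (by simp [hX, hX₁, hR0.ne'])
    (by simp [hX, hR0.ne']) (by simp [hX₁, hR0.ne']) (by simp [hX, hR0.ne'])
    (by simp [hX₁, hR0.ne']) (fun q hq => (heq q hq).2.2.2.2)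
  rw [← hB] at hzero
  set D : ℝ × ℝ → ℝ := fun q => q.1 * (w q.1 * X q.1 * X q.2 * (ur q ^ 2 + uz q ^ 2)
      + u q ^ 2 * (w q.1 * X q.1 * X q.2) / q.1 ^ 2
      - 1 / 2 * u q ^ 2 * (((w₂ q.1 * X q.1 + 2 * w₁ q.1 * X₁ q.1 + w q.1 * X₂ q.1)
        + (w₁ q.1 * X q.1 + w q.1 * X₁ q.1) / q.1) * X q.2 + w q.1 * X q.1 * X₂ q.2)
      + f q * uz q * (w q.1 * X q.1 * X q.2) + f q * u q * (w q.1 * X q.1 * X₁ q.2)) with hD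
  have hDi : IntegrableOn D B := by
    refine ContinuousOn.integrableOn_compact isCompact_Icc ?_
    simp only [hD]
    fun_prop (disch := assumption)
  have hEi : IntegrableOn (fun q : ℝ × ℝ => q.1 * w q.1 * f q ^ 2
      + 21 * M ^ 2 / R ^ 2 * (q.1 * w q.1)) B := by
    refine ContinuousOn.integrableOn_compact isCompact_Icc ?_
    fun_prop
  have hLi : IntegrableOn (fun q : ℝ × ℝ => q.1 * (w q.1 * quarticCutoff R q.1 *
        quarticCutoff R q.2 * streamEnergy u ur uz q)) B := by
    refine ContinuousOn.integrableOn_compact isCompact_Icc ?_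
    change ContinuousOn (fun q : ℝ × ℝ => q.1 * (w q.1 * X q.1 *
        X q.2 * streamEnergy u ur uz q)) B
    fun_prop
  rw [← zero_add (∫ q in B, (q.1 * w q.1 * f q ^ 2 + _)), ← hzero, ← integral_add hDi hEi]
  refine setIntegral_mono_on hLi (hDi.add hEi) measurableSet_Icc fun q hq => ?_
  have hq0 : 0 < q.1 := hr₀.trans_le hq.1.1
  have hq1 : q.1 ^ 2 / R ^ 2 ≤ 1 := sq_div_sq_le_one hR0 (abs_le.2 ⟨by linarith, hq.2.1⟩)
  have hq2 : q.2 ^ 2 / R ^ 2 ≤ 1 := sq_div_sq_le_one hR0 (abs_le.2 ⟨hq.1.2, hq.2.2⟩)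
  have hwp : 0 < w q.1 := streamWeight_pos hρ hq0
  have p1 : 0 ≤ q.1 ^ 2 / R ^ 2 := by positivity
  have p2 : 0 ≤ q.2 ^ 2 / R ^ 2 := by positivity
  have eX₂ : ∀ s, X₂ s = (-4 + 12 * (s ^ 2 / R ^ 2)) / R ^ 2 := fun s => by
    simp only [hX₂]; field_simp
  refine weighted_energy_density_le hq0 (hM q hq.1.1) hwp.le (hlap q.1 hq0)
    (sq_nonneg _) (pow_le_one₀ (by linarith) (by linarith)) (sq_nonneg _)
    (pow_le_one₀ (by linarith) (by linarith)) ?_ ?_ ?_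
  · have hX₁r : |X₁ q.1| ≤ 4 * q.1 / R ^ 2 := by
      simp only [hX₁]
      rw [abs_mul, abs_neg, abs_of_nonneg (by positivity : 0 ≤ 4 * q.1 / R ^ 2),
        abs_of_nonneg (by linarith)]
      exact mul_le_of_le_one_right (by positivity) (by linarith)
    have t1 : 2 * w₁ q.1 * X₁ q.1 ≤ 10 * w q.1 / R ^ 2 := by
      calc 2 * w₁ q.1 * X₁ q.1 = 2 * (w₁ q.1 * X₁ q.1) := by ring
        _ ≤ 2 * (|w₁ q.1| * |X₁ q.1|) := by
          rw [← abs_mul]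
          linarith [le_abs_self (w₁ q.1 * X₁ q.1)]
        _ ≤ 2 * ((5 / 4 * w q.1 / q.1) * (4 * q.1 / R ^ 2)) := by
          have : |w₁ q.1| * |X₁ q.1| ≤ 5 / 4 * w q.1 / q.1 * (4 * q.1 / R ^ 2) :=
            mul_le_mul (hw₁le q.1 hq0) hX₁r (abs_nonneg _)
              ((abs_nonneg _).trans (hw₁le q.1 hq0))
          linarith
        _ = _ := by field_simp; norm_num
    have t2 : X₂ q.1 + X₁ q.1 / q.1 ≤ 8 / R ^ 2 := by
      have : X₂ q.1 + X₁ q.1 / q.1 = (-8 + 16 * (q.1 ^ 2 / R ^ 2)) / R ^ 2 := by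
        rw [eX₂]
        simp only [hX₁]
        field_simp
        ring
      rw [this]
      gcongr
      linarith
    have t3 := mul_le_mul_of_nonneg_left t2 hwp.le
    calc _ ≤ 10 * w q.1 / R ^ 2 + w q.1 * (8 / R ^ 2) := add_le_add t1 t3
      _ = _ := by ring
  · have e1 : X₁ q.2 ^ 2 = 16 / R ^ 2 * ((q.2 ^ 2 / R ^ 2) * (1 - q.2 ^ 2 / R ^ 2) ^ 2) := by
      simp only [hX₁]
      field_simp
      ring
    rw [e1]
    refine mul_le_of_le_one_right (by positivity) (mul_le_one₀ hq2 (sq_nonneg _) ?_)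
    exact pow_le_one₀ (by linarith) (by linarith)
  · rw [eX₂]
    gcongr
    linarith

lemma mul_streamWeight_le {α ρ r : ℝ} (hα : α ≤ 1) (hρ : 0 < ρ) (hr : 0 < r) :
    r * streamWeight α ρ r ≤ r ^ (-(1 / 4) : ℝ) := by
  have h1 : (ρ + r) ^ (-(5 / 4 - α)) ≤ r ^ (-(5 / 4 - α)) :=
    Real.rpow_le_rpow_of_nonpos hr (by linarith) (by linarith)
  calc r * streamWeight α ρ r ≤ r * (r ^ (-α) * r ^ (-(5 / 4 - α))) := by
        unfold streamWeight
        gcongr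
    _ = r ^ (1 : ℝ) * (r ^ (-α) * r ^ (-(5 / 4 - α))) := by rw [Real.rpow_one]
    _ = _ := by
        rw [← Real.rpow_add hr, ← Real.rpow_add hr]
        congr 1
        ring

lemma integral_mul_streamWeight_le {α ρ r₀ R : ℝ} (hα : α ≤ 1) (hρ : 0 < ρ) (hr₀ : 0 < r₀)
    (hR : r₀ < R) :
    ∫ q in Icc (r₀, -R) (R, R), q.1 * streamWeight α ρ q.1 ≤ 8 / 3 * R ^ (7 / 4 : ℝ) := by
  have hR0 : 0 < R := hr₀.trans hR
  have hfst : MapsTo (Prod.fst : ℝ × ℝ → ℝ) (Icc (r₀, -R) (R, R)) (Ioi 0) :=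
    fun q hq => hr₀.trans_le hq.1.1
  have hwc := (continuousOn_streamWeight (α := α) hρ).comp continuousOn_fst hfst
  have hpow : ContinuousOn (fun q : ℝ × ℝ => q.1 ^ (-(1 / 4) : ℝ)) (Icc (r₀, -R) (R, R)) :=
    continuousOn_fst.rpow_const fun q hq => Or.inl (ne_of_gt (hfst hq))
  calc ∫ q in Icc (r₀, -R) (R, R), q.1 * streamWeight α ρ q.1
      ≤ ∫ q in Icc (r₀, -R) (R, R), q.1 ^ (-(1 / 4) : ℝ) :=
        setIntegral_mono_on ((continuousOn_fst.mul hwc).integrableOn_compact isCompact_Icc)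
          (hpow.integrableOn_compact isCompact_Icc) measurableSet_Icc
          fun q hq => mul_streamWeight_le hα hρ (hfst hq)
    _ = (∫ r in Icc r₀ R, r ^ (-(1 / 4) : ℝ)) * ∫ _z in Icc (-R) R, (1 : ℝ) := by
        rw [← Icc_prod_Icc, Measure.volume_eq_prod, ← setIntegral_prod_mul]
        simp
    _ = (R ^ (3 / 4 : ℝ) - r₀ ^ (3 / 4 : ℝ)) / (3 / 4) * (2 * R) := by
        rw [integral_Icc_eq_integral_Ioc, ← intervalIntegral.integral_of_le hR.le,
          integral_rpow (Or.inl (by norm_num))]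
        have : (-(1 / 4) + 1 : ℝ) = 3 / 4 := by norm_num
        rw [this, setIntegral_const, Real.volume_real_Icc_of_le (by linarith), smul_eq_mul]
        ring
    _ ≤ R ^ (3 / 4 : ℝ) / (3 / 4) * (2 * R) := by
        have := Real.rpow_nonneg hr₀.le (3 / 4)
        gcongr
        linarith
    _ = 8 / 3 * (R ^ (3 / 4 : ℝ) * R ^ (1 : ℝ)) := by
        rw [Real.rpow_one]
        ring
    _ = _ := by
        rw [← Real.rpow_add hR0]
        norm_num

/-- The energy of a bounded solution on a rectangle, weighted by `r ^ (-α)`, is controlled by the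
weighted `L²` norm of the source on the whole half plane. -/
lemma IsStreamSolution.integral_energy_le {α r₀ A M F : ℝ} {u ur uz f : ℝ × ℝ → ℝ}
    (h : IsStreamSolution r₀ u ur uz f) (hα : α ∈ Ioc (0 : ℝ) 1) (hr₀ : 0 < r₀) (hA : r₀ < A)
    (hM : ∀ q : ℝ × ℝ, r₀ ≤ q.1 → |u q| ≤ M)
    (hF : ∀ R, r₀ < R → ∫ q in Icc (r₀, -R) (R, R), q.1 * (q.1 ^ (-α) * f q ^ 2) ≤ F) :
    ∫ q in Icc (r₀, -A) (A, A), q.1 * (q.1 ^ (-α) * streamEnergy u ur uz q) ≤ F := by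
  have hA0 : 0 < A := hr₀.trans hA
  set γ := 5 / 4 - α with hγ
  have hγ0 : 0 < γ := by linarith [hα.2]
  set I := ∫ q in Icc (r₀, -A) (A, A), q.1 * (q.1 ^ (-α) * streamEnergy u ur uz q) with hI
  have hfst : ∀ R, MapsTo (Prod.fst : ℝ × ℝ → ℝ) (Icc (r₀, -R) (R, R)) (Ioi 0) :=
    fun R q hq => hr₀.trans_le hq.1.1
  have hsub : ∀ R, Icc (r₀, -R) (R, R) ⊆ {q : ℝ × ℝ | r₀ ≤ q.1} := fun R q hq => hq.1.1
  have hpow : ∀ R, ContinuousOn (fun q : ℝ × ℝ => q.1 ^ (-α)) (Icc (r₀, -R) (R, R)) := fun R =>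
    continuousOn_fst.rpow_const fun q hq => Or.inl (ne_of_gt (hfst R hq))
  have hE := fun R => (h.continuousOn_streamEnergy hr₀).mono (hsub R)
  have hf := fun R => h.continuousOn_source.mono (hsub R)
  have hIi : IntegrableOn (fun q : ℝ × ℝ => q.1 * (q.1 ^ (-α) * streamEnergy u ur uz q))
      (Icc (r₀, -A) (A, A)) :=
    (continuousOn_fst.mul ((hpow A).mul (hE A))).integrableOn_compact isCompact_Icc
  have step : ∀ ρ R, 0 < ρ → A < R → (ρ + A) ^ (-γ) * (1 - A ^ 2 / R ^ 2) ^ 4 * I ≤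
      ρ ^ (-γ) * F + 56 * M ^ 2 * R ^ (-(1 / 4) : ℝ) := by
    intro ρ R hρ hAR
    have hR : r₀ < R := hA.trans hAR
    have hR0 : 0 < R := hr₀.trans hR
    have hwc := (continuousOn_streamWeight (α := α) hρ).comp continuousOn_fst (hfst R)
    have hXc : Continuous (quarticCutoff R) := by
      unfold quarticCutoff
      fun_prop
    have hX1 : Continuous (fun q : ℝ × ℝ => quarticCutoff R q.1) := hXc.comp continuous_fst
    have hX2 : Continuous (fun q : ℝ × ℝ => quarticCutoff R q.2) := hXc.comp continuous_snd
    have hLi : IntegrableOn (fun q : ℝ × ℝ => q.1 * (streamWeight α ρ q.1 * quarticCutoff R q.1 *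
        quarticCutoff R q.2 * streamEnergy u ur uz q)) (Icc (r₀, -R) (R, R)) :=
      (continuousOn_fst.mul (((hwc.mul hX1.continuousOn).mul hX2.continuousOn).mul
        (hE R))).integrableOn_compact isCompact_Icc
    have hKR : Icc ((r₀, -A) : ℝ × ℝ) (A, A) ⊆ Icc (r₀, -R) (R, R) :=
      Icc_subset_Icc ⟨le_rfl, by simpa using hAR.le⟩ ⟨hAR.le, hAR.le⟩
    have hAR' : A ^ 2 / R ^ 2 ≤ 1 := sq_div_sq_le_one hR0 (by rw [abs_of_pos hA0]; exact hAR.le)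
    have lower : (ρ + A) ^ (-γ) * (1 - A ^ 2 / R ^ 2) ^ 4 * I ≤
        ∫ q in Icc (r₀, -R) (R, R), q.1 * (streamWeight α ρ q.1 * quarticCutoff R q.1 *
        quarticCutoff R q.2 * streamEnergy u ur uz q) := by
      rw [hI, ← integral_const_mul]
      refine (setIntegral_mono_on (hIi.const_mul _) (hLi.mono_set hKR) measurableSet_Icc
        fun q hq => ?_).trans (setIntegral_mono_set hLi ?_ hKR.eventuallyLE)
      · have hq0 : 0 < q.1 := hfst A hq
        have hcut : ∀ s, |s| ≤ A → (1 - A ^ 2 / R ^ 2) ^ 2 ≤ quarticCutoff R s := by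
          intro s hs
          have : s ^ 2 ≤ A ^ 2 := sq_le_sq' (neg_le_of_abs_le hs) (le_of_abs_le hs)
          unfold quarticCutoff
          gcongr
        have hc1 := hcut q.1 (abs_le.2 ⟨by linarith, hq.2.1⟩)
        have hc2 := hcut q.2 (abs_le.2 ⟨hq.1.2, hq.2.2⟩)
        have hw : (ρ + A) ^ (-γ) ≤ (ρ + q.1) ^ (-γ) :=
          Real.rpow_le_rpow_of_nonpos (by positivity) (by linarith [hq.2.1]) (by linarith)
        have hen := streamEnergy_nonneg u ur uz q
        calc _ = q.1 * (q.1 ^ (-α) * (ρ + A) ^ (-γ) * (1 - A ^ 2 / R ^ 2) ^ 2 *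
              (1 - A ^ 2 / R ^ 2) ^ 2 * streamEnergy u ur uz q) := by ring
          _ ≤ q.1 * (q.1 ^ (-α) * (ρ + q.1) ^ (-γ) * quarticCutoff R q.1 *
              quarticCutoff R q.2 * streamEnergy u ur uz q) := by
            gcongr
            unfold quarticCutoff
            positivity
      · refine (ae_restrict_iff' measurableSet_Icc).2 (Filter.Eventually.of_forall fun q hq => ?_)
        have hq0 : 0 < q.1 := hfst R hq
        have hen := streamEnergy_nonneg u ur uz q
        have := streamWeight_pos (α := α) hρ hq0
        simp only [quarticCutoff, Pi.zero_apply]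
        positivity
    have hFi : IntegrableOn (fun q : ℝ × ℝ => q.1 * streamWeight α ρ q.1 * f q ^ 2)
        (Icc (r₀, -R) (R, R)) :=
      ((continuousOn_fst.mul hwc).mul ((hf R).pow 2)).integrableOn_compact isCompact_Icc
    have hWi : IntegrableOn (fun q : ℝ × ℝ => q.1 * streamWeight α ρ q.1)
        (Icc (r₀, -R) (R, R)) :=
      (continuousOn_fst.mul hwc).integrableOn_compact isCompact_Icc
    have hFi' : IntegrableOn (fun q : ℝ × ℝ => q.1 * (q.1 ^ (-α) * f q ^ 2))
        (Icc (r₀, -R) (R, R)) :=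
      (continuousOn_fst.mul ((hpow R).mul ((hf R).pow 2))).integrableOn_compact isCompact_Icc
    have upper1 : ∫ q in Icc (r₀, -R) (R, R), q.1 * streamWeight α ρ q.1 * f q ^ 2 ≤
        ρ ^ (-γ) * F := by
      refine le_trans ?_ (mul_le_mul_of_nonneg_left (hF R hR) (Real.rpow_nonneg hρ.le _))
      rw [← integral_const_mul]
      refine setIntegral_mono_on hFi (hFi'.const_mul _) measurableSet_Icc fun q hq => ?_
      have hq0 : 0 < q.1 := hfst R hq
      have hw : (ρ + q.1) ^ (-γ) ≤ ρ ^ (-γ) :=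
        Real.rpow_le_rpow_of_nonpos hρ (by linarith) (by linarith)
      calc q.1 * (q.1 ^ (-α) * (ρ + q.1) ^ (-γ)) * f q ^ 2
          ≤ q.1 * (q.1 ^ (-α) * ρ ^ (-γ)) * f q ^ 2 := by gcongr
        _ = _ := by ring
    have upper2 : 21 * M ^ 2 / R ^ 2 *
        ∫ q in Icc (r₀, -R) (R, R), q.1 * streamWeight α ρ q.1 ≤
        56 * M ^ 2 * R ^ (-(1 / 4) : ℝ) := by
      calc _ ≤ 21 * M ^ 2 / R ^ 2 * (8 / 3 * R ^ (7 / 4 : ℝ)) := by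
            gcongr
            exact integral_mul_streamWeight_le hα.2 hρ hr₀ hR
        _ = 56 * M ^ 2 * (R ^ (7 / 4 : ℝ) / R ^ (2 : ℝ)) := by
            rw [Real.rpow_two]
            ring
        _ = _ := by
            rw [← Real.rpow_sub hR0]
            norm_num
    have hmain := h.integral_weighted_le hα hρ hr₀ hR hM
    rw [integral_add hFi (hWi.const_mul _), integral_const_mul] at hmain
    linarith
  have hρlim : ∀ ρ, 0 < ρ → (ρ + A) ^ (-γ) * I ≤ ρ ^ (-γ) * F := by
    intro ρ hρ
    have l1 : Filter.Tendsto (fun R : ℝ => A ^ 2 / R ^ 2) Filter.atTop (nhds 0) :=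
      Filter.Tendsto.div_atTop tendsto_const_nhds (Filter.tendsto_pow_atTop two_ne_zero)
    have l2 : Filter.Tendsto (fun R : ℝ => (ρ + A) ^ (-γ) * (1 - A ^ 2 / R ^ 2) ^ 4 * I)
        Filter.atTop (nhds ((ρ + A) ^ (-γ) * (1 - 0) ^ 4 * I)) :=
      (((l1.const_sub 1).pow 4).const_mul _).mul_const _
    have l3 : Filter.Tendsto
        (fun R : ℝ => ρ ^ (-γ) * F + 56 * M ^ 2 * R ^ (-(1 / 4) : ℝ))
        Filter.atTop (nhds (ρ ^ (-γ) * F + 56 * M ^ 2 * 0)) :=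
      ((tendsto_rpow_neg_atTop (by norm_num)).const_mul _).const_add _
    have := le_of_tendsto_of_tendsto l2 l3
      ((Filter.eventually_gt_atTop A).mono fun R hR => step ρ R hρ hR)
    simpa using this
  have l1 : Filter.Tendsto (fun ρ : ℝ => (1 + A / ρ) ^ (-γ) * I) Filter.atTop
      (nhds ((1 + 0) ^ (-γ) * I)) :=
    (((Filter.Tendsto.div_atTop tendsto_const_nhds Filter.tendsto_id).const_add 1).rpow_const
      (Or.inl (by norm_num))).mul_const _
  have := le_of_tendsto l1 (b := F) ((Filter.eventually_gt_atTop 0).mono fun ρ hρ => ?_)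
  · simpa using this
  · have h1 := hρlim ρ hρ
    have h2 : (ρ + A) ^ (-γ) = ρ ^ (-γ) * (1 + A / ρ) ^ (-γ) := by
      rw [← Real.mul_rpow hρ.le (by positivity)]
      congr 1
      field_simp
    rw [h2, mul_assoc] at h1
    exact le_of_mul_le_mul_left h1 (by positivity)

lemma measurable_rad : Measurable rad := by
  unfold rad
  fun_prop

/-- Integration of an axisymmetric function in cylindrical coordinates. -/
lemma lintegral_axisymmetric {h : ℝ × ℝ → ℝ≥0∞} (hh : Measurable h) :
    ∫⁻ x : Fin 3 → ℝ, h (rad x, x 2) =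
      ∫⁻ q in Ioi (0 : ℝ) ×ˢ univ, ENNReal.ofReal (2 * π) * (ENNReal.ofReal q.1 * h q) := by
  have hmeas : Measurable (fun p : ℝ × (ℝ × ℝ) => h (√(p.2.1 ^ 2 + p.2.2 ^ 2), p.1)) :=
    hh.comp (by fun_prop)
  have e1 := volume_preserving_piFinSuccAbove (fun _ : Fin 3 => ℝ) 2
  have e2 := (MeasurePreserving.id (volume : Measure ℝ)).prod (volume_preserving_finTwoArrow ℝ)
  have e3 := e2.comp e1
  have hpolar : ∀ z : ℝ, ∫⁻ p : ℝ × ℝ, h (√(p.1 ^ 2 + p.2 ^ 2), z) =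
      ∫⁻ r in Ioi (0 : ℝ), ENNReal.ofReal (2 * π) * (ENNReal.ofReal r * h (r, z)) := by
    intro z
    have hz : Measurable fun r : ℝ => ENNReal.ofReal r * h (r, z) :=
      ENNReal.measurable_ofReal.mul (hh.comp (by fun_prop))
    rw [← lintegral_comp_polarCoord_symm]
    calc _ = ∫⁻ p in Ioi (0 : ℝ) ×ˢ Ioo (-π) π, ENNReal.ofReal p.1 * h (p.1, z) := by
          refine setLIntegral_congr_fun (measurableSet_Ioi.prod measurableSet_Ioo) fun p hp => ?_
          have hp0 : 0 < p.1 := hp.1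
          have : (p.1 * cos p.2) ^ 2 + (p.1 * sin p.2) ^ 2 = p.1 ^ 2 := by
            linear_combination p.1 ^ 2 * Real.sin_sq_add_cos_sq p.2
          simp only [polarCoord_symm_apply, this, Real.sqrt_sq hp0.le, smul_eq_mul]
      _ = ∫⁻ r in Ioi (0 : ℝ), ∫⁻ _θ in Ioo (-π) π, ENNReal.ofReal r * h (r, z) := by
          rw [Measure.volume_eq_prod, ← Measure.prod_restrict]
          exact lintegral_prod _ (hz.comp measurable_fst).aemeasurable
      _ = _ := by
          refine lintegral_congr fun r => ?_
          rw [setLIntegral_const, Real.volume_Ioo, mul_comm]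
          congr 2
          ring
  calc ∫⁻ x : Fin 3 → ℝ, h (rad x, x 2)
      = ∫⁻ p : ℝ × (ℝ × ℝ), h (√(p.2.1 ^ 2 + p.2.2 ^ 2), p.1) :=
        e3.lintegral_comp hmeas
    _ = ∫⁻ z : ℝ, ∫⁻ r in Ioi (0 : ℝ), ENNReal.ofReal (2 * π) * (ENNReal.ofReal r * h (r, z)) := by
        rw [Measure.volume_eq_prod, lintegral_prod _ hmeas.aemeasurable]
        exact lintegral_congr hpolar
    _ = ∫⁻ r in Ioi (0 : ℝ), ∫⁻ z : ℝ, ENNReal.ofReal (2 * π) * (ENNReal.ofReal r * h (r, z)) :=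
        lintegral_lintegral_swap (Measurable.aemeasurable (by fun_prop))
    _ = _ := by
        rw [Measure.volume_eq_prod, ← Measure.prod_restrict, Measure.restrict_univ,
          lintegral_prod _ (Measurable.aemeasurable (by fun_prop))]

/-- The integral over the exterior of a cylinder, as an integral over a half plane. -/
lemma spIntegralOn_eq {ε : ℝ} (hε : 0 < ε) {g : ℝ → ℝ → ℝ} {G : ℝ × ℝ → ℝ}
    (hG : ContinuousOn G {q | ε ≤ q.1}) (hg : ∀ r z, ε < r → g r z = G (r, z)) :
    spIntegralOn ε g = ENNReal.ofReal (2 * π) *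
      ∫⁻ q in {q : ℝ × ℝ | ε < q.1}, ENNReal.ofReal (q.1 * G q) := by
  classical
  have hS : MeasurableSet {q : ℝ × ℝ | ε < q.1} := measurableSet_lt measurable_const measurable_fst
  have hGm : Measurable ({q : ℝ × ℝ | ε < q.1}.indicator fun q => ENNReal.ofReal (G q)) := by
    have h1 : ContinuousOn (fun q => ENNReal.ofReal (G q)) {q : ℝ × ℝ | ε < q.1} :=
      ENNReal.continuous_ofReal.comp_continuousOn
        (hG.mono fun q (hq : ε < q.1) => hq.le)
    rw [← piecewise_eq_indicator]
    exact h1.measurable_piecewise continuousOn_const hS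
  have h3 : MeasurableSet {x : Fin 3 → ℝ | ε < rad x} :=
    measurableSet_lt measurable_const measurable_rad
  unfold spIntegralOn
  rw [← lintegral_indicator h3]
  have e1 : ∀ x : Fin 3 → ℝ, {x : Fin 3 → ℝ | ε < rad x}.indicator
      (fun x => ENNReal.ofReal (g (rad x) (x 2))) x =
      {q : ℝ × ℝ | ε < q.1}.indicator (fun q => ENNReal.ofReal (G q)) (rad x, x 2) := by
    intro x
    by_cases hx : ε < rad x
    · rw [indicator_of_mem (by exact hx), indicator_of_mem (by exact hx), hg _ _ hx]
    · rw [indicator_of_notMem (by exact hx), indicator_of_notMem (by exact hx)]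
  rw [lintegral_congr e1, lintegral_axisymmetric hGm, lintegral_const_mul _ (by fun_prop),
    ← lintegral_indicator (measurableSet_Ioi.prod MeasurableSet.univ), ← lintegral_indicator hS]
  congr 1
  refine lintegral_congr fun q => ?_
  by_cases hq : ε < q.1
  · have hq0 : 0 < q.1 := hε.trans hq
    rw [indicator_of_mem (by exact ⟨hq0, mem_univ _⟩), indicator_of_mem (by exact hq),
      indicator_of_mem (by exact hq), ENNReal.ofReal_mul hq0.le]
  · rw [indicator_of_notMem (s := {q : ℝ × ℝ | ε < q.1}) (by exact hq)]
    rw [indicator_apply]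
    split_ifs
    · rw [indicator_of_notMem (by exact hq), mul_zero]
    · rfl

/-- The energy estimate for bounded solutions on the half plane. -/
lemma IsStreamSolution.lintegral_energy_le {α r₀ M : ℝ} {u ur uz f : ℝ × ℝ → ℝ}
    (h : IsStreamSolution r₀ u ur uz f) (hα : α ∈ Ioc (0 : ℝ) 1) (hr₀ : 0 < r₀)
    (hM : ∀ q : ℝ × ℝ, r₀ ≤ q.1 → |u q| ≤ M) :
    ∫⁻ q in {q : ℝ × ℝ | r₀ < q.1},
        ENNReal.ofReal (q.1 * (q.1 ^ (-α) * streamEnergy u ur uz q)) ≤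
      ∫⁻ q in {q : ℝ × ℝ | r₀ < q.1}, ENNReal.ofReal (q.1 * (q.1 ^ (-α) * f q ^ 2)) := by
  set T := ∫⁻ q in {q : ℝ × ℝ | r₀ < q.1}, ENNReal.ofReal (q.1 * (q.1 ^ (-α) * f q ^ 2)) with hT
  rcases eq_or_ne T ⊤ with hTtop | hTtop
  · rw [hTtop]
    exact le_top
  have hfst : ∀ R, MapsTo (Prod.fst : ℝ × ℝ → ℝ) (Icc (r₀, -R) (R, R)) (Ioi 0) :=
    fun R q hq => hr₀.trans_le hq.1.1
  have hsub : ∀ R, Icc (r₀, -R) (R, R) ⊆ {q : ℝ × ℝ | r₀ ≤ q.1} := fun R q hq => hq.1.1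
  have hpow : ∀ R, ContinuousOn (fun q : ℝ × ℝ => q.1 ^ (-α)) (Icc (r₀, -R) (R, R)) := fun R =>
    continuousOn_fst.rpow_const fun q hq => Or.inl (ne_of_gt (hfst R hq))
  have hofReal : ∀ (R : ℝ) (g : ℝ × ℝ → ℝ), ContinuousOn g {q | r₀ ≤ q.1} → (∀ q, 0 ≤ g q) →
      ENNReal.ofReal (∫ q in Icc (r₀, -R) (R, R), q.1 * (q.1 ^ (-α) * g q)) =
        ∫⁻ q in Icc (r₀, -R) (R, R), ENNReal.ofReal (q.1 * (q.1 ^ (-α) * g q)) := by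
    intro R g hg hg0
    refine ofReal_integral_eq_lintegral_ofReal ((continuousOn_fst.mul
      ((hpow R).mul (hg.mono (hsub R)))).integrableOn_compact isCompact_Icc) ?_
    refine (ae_restrict_iff' measurableSet_Icc).2 (Filter.Eventually.of_forall fun q hq => ?_)
    have hq0 : 0 < q.1 := hfst R hq
    have := hg0 q
    simp only [Pi.zero_apply]
    positivity
  have hS : ({q : ℝ × ℝ | r₀ < q.1} : Set (ℝ × ℝ)) =ᵐ[volume] {q : ℝ × ℝ | r₀ ≤ q.1} := by
    have := Measure.set_prod_ae_eq (μ := (volume : Measure ℝ)) (ν := (volume : Measure ℝ))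
      (Ioi_ae_eq_Ici (a := r₀)) (Filter.EventuallyEq.refl _ (univ : Set ℝ))
    rwa [prod_univ, prod_univ] at this
  have hF : ∀ R, r₀ < R →
      ∫ q in Icc (r₀, -R) (R, R), q.1 * (q.1 ^ (-α) * f q ^ 2) ≤ T.toReal := by
    intro R _
    rw [← ENNReal.ofReal_le_iff_le_toReal hTtop,
      hofReal R (fun q => f q ^ 2) (h.continuousOn_source.pow 2) (fun q => sq_nonneg _), hT,
      setLIntegral_congr hS]
    exact lintegral_mono_set (hsub R)
  have hcover : {q : ℝ × ℝ | r₀ < q.1} ⊆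
      ⋃ n : ℕ, Icc ((r₀, -(r₀ + 1 + n)) : ℝ × ℝ) (r₀ + 1 + n, r₀ + 1 + n) := by
    intro q hq
    obtain ⟨n, hn⟩ := exists_nat_ge (max q.1 |q.2|)
    have h1 := (le_max_left _ _).trans hn
    obtain ⟨h2, h3⟩ := abs_le.1 ((le_max_right _ _).trans hn)
    have hq' : r₀ < q.1 := hq
    exact mem_iUnion.2 ⟨n, ⟨hq'.le, by dsimp; linarith⟩, by dsimp; linarith, by dsimp; linarith⟩
  refine (lintegral_mono_set hcover).trans ?_
  rw [setLIntegral_iUnion_of_directed]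
  · refine iSup_le fun n => ?_
    rw [← hofReal _ _ (h.continuousOn_streamEnergy hr₀) (streamEnergy_nonneg u ur uz)]
    refine ENNReal.ofReal_le_of_le_toReal (h.integral_energy_le hα hr₀ ?_ hM hF)
    have : (0 : ℝ) ≤ n := n.cast_nonneg
    linarith
  · refine Monotone.directed_le fun m n hmn => ?_
    have : (m : ℝ) ≤ n := by exact_mod_cast hmn
    exact Icc_subset_Icc ⟨le_rfl, by dsimp; linarith⟩ ⟨by dsimp; linarith, by dsimp; linarith⟩

/-- A function decaying at infinity and continuous on a half plane is bounded there. -/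
lemma DecayAtInfinity2.exists_bound {r₀ : ℝ} {g : ℝ → ℝ → ℝ} {G : ℝ × ℝ → ℝ}
    (hg : DecayAtInfinity2 g) (hG : ContinuousOn G {q | r₀ ≤ q.1})
    (hgG : ∀ r z, r₀ ≤ r → g r z = G (r, z)) :
    ∃ M, ∀ q : ℝ × ℝ, r₀ ≤ q.1 → |G q| ≤ M := by
  obtain ⟨R, hR⟩ := hg 1 one_pos
  obtain ⟨C, hC⟩ := (isCompact_Icc (a := ((r₀, -R) : ℝ × ℝ)) (b := (R, R))).exists_bound_of_continuousOn
    (hG.mono fun q hq => hq.1.1)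
  refine ⟨max C 1, fun q hq => ?_⟩
  by_cases hcase : R ≤ q.1 ∨ R ≤ |q.2|
  · have := hR q.1 q.2 hcase
    rw [hgG _ _ hq] at this
    exact this.trans (le_max_right _ _)
  · push Not at hcase
    obtain ⟨h2, h3⟩ := abs_lt.1 hcase.2
    exact (hC q ⟨⟨hq, h2.le⟩, hcase.1.le, h3.le⟩).trans (le_max_left _ _)

/-- The coordinate derivatives of a function agreeing with a differentiable one on a half plane. -/
lemma pdr2_pdz2_eq {r₀ r z : ℝ} {g : ℝ → ℝ → ℝ} {G Gr Gz : ℝ × ℝ → ℝ}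
    (hgG : ∀ r z, r₀ < r → g r z = G (r, z)) (hr : r₀ < r)
    (hG : ∀ q : ℝ × ℝ, r₀ < q.1 → HasFDerivAt G
      (Gr q • ContinuousLinearMap.fst ℝ ℝ ℝ + Gz q • ContinuousLinearMap.snd ℝ ℝ ℝ) q) :
    pdr2 g r z = Gr (r, z) ∧ pdz2 g r z = Gz (r, z) := by
  have hd := hG (r, z) hr
  constructor
  · have hline : HasDerivAt (fun s : ℝ => (s, z)) ((1 : ℝ), (0 : ℝ)) r :=
      (hasDerivAt_id r).prodMk (hasDerivAt_const r z)
    have h1 : HasDerivAt (fun s => G (s, z)) (Gr (r, z)) r := by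
      simpa [Function.comp_def] using hd.comp_hasDerivAt r hline
    refine (h1.congr_of_eventuallyEq ?_).deriv
    filter_upwards [lt_mem_nhds hr] with s hs using hgG s z hs
  · have hline : HasDerivAt (fun s : ℝ => (r, s)) ((0 : ℝ), (1 : ℝ)) z :=
      (hasDerivAt_const z r).prodMk (hasDerivAt_id z)
    have h1 : HasDerivAt (fun s => G (r, s)) (Gz (r, z)) z := by
      simpa [Function.comp_def] using hd.comp_hasDerivAt z hline
    refine (h1.congr_of_eventuallyEq ?_).deriv
    exact Filter.Eventually.of_forall fun s => hgG r s hr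

/-- **Estimate (3.28)**: if `u = ψ_{,z}` solves `−∆u + u/r² = f_{,z}` in `ℝ³_ε` with
`ψ` vanishing at `r = ε` and decaying at infinity, then for `α ∈ (0,1]`,
`∫_{ℝ³_ε} r^{−α}|∇ψ_{,z}|² dx + (1 − α²/2)∫_{ℝ³_ε} ψ_{,z}²/r^{2+α} dx
   ≤ c ∫_{ℝ³_ε} f²/r^α dx`, with `c = c(α)`. -/
theorem weighted_stream_estimate (α : ℝ) (hα : α ∈ Set.Ioc (0:ℝ) 1) :
    ∃ c : ℝ, 0 < c ∧
      ∀ (ε : ℝ) (ψ f : ℝ → ℝ → ℝ),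
        0 < ε →
        -- `ψ`, `f` are smooth on `ℝ³_ε` and depend only on `(r, z)`
        ContDiffOn ℝ (⊤ : ℕ∞) (fun q : ℝ × ℝ => ψ q.1 q.2) {q : ℝ × ℝ | ε ≤ q.1} →
        ContDiffOn ℝ (⊤ : ℕ∞) (fun q : ℝ × ℝ => f q.1 q.2) {q : ℝ × ℝ | ε ≤ q.1} →
        -- `ψ` vanishes at `r = ε`, and `ψ`, `f` decay at infinity
        (∀ z : ℝ, ψ ε z = 0) →
        DecayAtInfinity2 ψ → DecayAtInfinity2 (pdz2 ψ) → DecayAtInfinity2 f →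
        -- `u = ψ_{,z}` satisfies `−∆u + u/r² = f_{,z}` on `ℝ³_ε`
        (∀ r z : ℝ, ε < r →
          - cylLap2 (pdz2 ψ) r z + pdz2 ψ r z / r ^ 2 = pdz2 f r z) →
        spIntegralOn ε
            (fun r z => ((pdr2 (pdz2 ψ) r z) ^ 2 + (pdz2 (pdz2 ψ) r z) ^ 2) / r ^ α)
          + ENNReal.ofReal (1 - α ^ 2 / 2) *
              spIntegralOn ε (fun r z => (pdz2 ψ r z) ^ 2 / r ^ (2 + α))
          ≤ ENNReal.ofReal c * spIntegralOn ε (fun r z => (f r z) ^ 2 / r ^ α) := by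
  refine ⟨32 / 7, by norm_num, fun ε ψ f hε hψ hf hψ0 _ hdecay _ hpde => ?_⟩
  obtain ⟨_, u, _, hu, _, hψz⟩ := exists_partials_halfPlane hψ
  obtain ⟨ur, uz, hur, huz, hdu, _⟩ := exists_partials_halfPlane hu
  obtain ⟨urr, urz, _, _, hdur, _⟩ := exists_partials_halfPlane hur
  obtain ⟨uzr, uzz, _, _, hduz, _⟩ := exists_partials_halfPlane huz
  obtain ⟨fr, fz, _, _, hdf, _⟩ := exists_partials_halfPlane hf
  have eu : ∀ r z, ε ≤ r → pdz2 ψ r z = u (r, z) := fun r z hr => (hψz (r, z) hr).deriv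
  have eu' : ∀ r z, ε < r → pdz2 ψ r z = u (r, z) := fun r z hr => eu r z hr.le
  have eur : ∀ r z, ε < r → pdr2 (pdz2 ψ) r z = ur (r, z) := fun r z hr =>
    (pdr2_pdz2_eq eu' hr hdu).1
  have euz : ∀ r z, ε < r → pdz2 (pdz2 ψ) r z = uz (r, z) := fun r z hr =>
    (pdr2_pdz2_eq eu' hr hdu).2
  have hsol : IsStreamSolution ε u ur uz (fun q => f q.1 q.2) := by
    refine ⟨hu.continuousOn, hur.continuousOn, huz.continuousOn, hf.continuousOn, fun z => ?_,
      urr, urz, uzr, uzz, fr, fz, fun q hq =>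
      ⟨hdu q hq, hdur q hq, hduz q hq, hdf q hq, ?_⟩⟩
    · rw [← eu ε z le_rfl]
      simp [pdz2, hψ0]
    · have := hpde q.1 q.2 hq
      rwa [cylLap2, (pdr2_pdz2_eq eur hq hdur).1, (pdr2_pdz2_eq euz hq hduz).2, eur _ _ hq,
        eu' _ _ hq, (pdr2_pdz2_eq (fun _ _ _ => rfl) hq hdf).2] at this
  obtain ⟨M, hM⟩ := hdecay.exists_bound hu.continuousOn eu
  have hpow : ∀ p : ℝ, ContinuousOn (fun q : ℝ × ℝ => q.1 ^ p) {q : ℝ × ℝ | ε ≤ q.1} := fun p =>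
    continuousOn_fst.rpow_const fun q hq => Or.inl (hε.trans_le hq).ne'
  have hpow0 : ∀ p : ℝ, ∀ q ∈ {q : ℝ × ℝ | ε ≤ q.1}, q.1 ^ p ≠ 0 := fun p q hq =>
    (Real.rpow_pos_of_pos (hε.trans_le hq) p).ne'
  rw [spIntegralOn_eq hε (G := fun q => (ur q ^ 2 + uz q ^ 2) / q.1 ^ α)
      (((hur.continuousOn.pow 2).add (huz.continuousOn.pow 2)).div (hpow α) (hpow0 α))
      (fun r z hr => by rw [eur r z hr, euz r z hr]),
    spIntegralOn_eq hε (G := fun q => u q ^ 2 / q.1 ^ (2 + α))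
      ((hu.continuousOn.pow 2).div (hpow (2 + α)) (hpow0 (2 + α)))
      (fun r z hr => by rw [eu' r z hr]),
    spIntegralOn_eq hε (G := fun q => f q.1 q.2 ^ 2 / q.1 ^ α)
      ((hf.continuousOn.pow 2).div (hpow α) (hpow0 α)) (fun r z hr => rfl),
    mul_left_comm, ← mul_add, mul_left_comm (ENNReal.ofReal (32 / 7))]
  gcongr
  have hS : MeasurableSet {q : ℝ × ℝ | ε < q.1} := measurableSet_lt measurable_const measurable_fst
  have hneg : ∀ q : ℝ × ℝ, ε < q.1 → q.1 ^ (-α) = (q.1 ^ α)⁻¹ := fun q hq =>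
    Real.rpow_neg (hε.trans hq).le α
  have henergy := hsol.lintegral_energy_le hα hε hM
  rw [← lintegral_const_mul' _ _ ENNReal.ofReal_ne_top]
  calc _ ≤ ∫⁻ q in {q : ℝ × ℝ | ε < q.1},
        (ENNReal.ofReal (q.1 * ((ur q ^ 2 + uz q ^ 2) / q.1 ^ α)) +
          ENNReal.ofReal (1 - α ^ 2 / 2) * ENNReal.ofReal (q.1 * (u q ^ 2 / q.1 ^ (2 + α)))) :=
        le_lintegral_add _ _
    _ ≤ ∫⁻ q in {q : ℝ × ℝ | ε < q.1}, ENNReal.ofReal (32 / 7) *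
        ENNReal.ofReal (q.1 * (q.1 ^ (-α) * streamEnergy u ur uz q)) := by
      refine setLIntegral_mono' hS fun q hq => ?_
      have hq0 : 0 < q.1 := hε.trans hq
      have hα2 : 0 ≤ 1 - α ^ 2 / 2 := by nlinarith [hα.1, hα.2]
      rw [← ENNReal.ofReal_mul hα2, ← ENNReal.ofReal_add (by positivity) (by positivity),
        ← ENNReal.ofReal_mul (by norm_num)]
      refine ENNReal.ofReal_le_ofReal ?_
      rw [hneg q hq, Real.rpow_add hq0, Real.rpow_two, streamEnergy]
      have h1 : 0 ≤ q.1 * ((ur q ^ 2 + uz q ^ 2) / q.1 ^ α) := by positivity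
      have h2 : (1 - α ^ 2 / 2) * (q.1 * (u q ^ 2 / (q.1 ^ 2 * q.1 ^ α))) ≤
          q.1 * (u q ^ 2 / (q.1 ^ 2 * q.1 ^ α)) :=
        mul_le_of_le_one_left (by positivity) (by nlinarith [hα.1])
      calc _ ≤ 16 / 7 * (q.1 * ((ur q ^ 2 + uz q ^ 2) / q.1 ^ α)) +
            q.1 * (u q ^ 2 / (q.1 ^ 2 * q.1 ^ α)) := by linarith
        _ = _ := by
          field_simp
          ring
    _ = ENNReal.ofReal (32 / 7) * ∫⁻ q in {q : ℝ × ℝ | ε < q.1},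
        ENNReal.ofReal (q.1 * (q.1 ^ (-α) * streamEnergy u ur uz q)) :=
      lintegral_const_mul' _ _ ENNReal.ofReal_ne_top
    _ ≤ _ := by
      refine mul_le_mul' le_rfl (henergy.trans_eq (setLIntegral_congr_fun hS fun q hq => ?_))
      simp only [hneg q hq]
      congr 2
      ring
end
end

section
/- Let (v,p) be a smooth axisymmetric solution of the Navier–Stokes equations on ℝ³×(0,T) with viscosity ν>0 satisfying the energy inequality ∫|v(t)|² dx + ν∫₀^t∫(|∇v|² + |v_r/r|² + |v_φ/r|²) dx dt' ≤ c‖v(0)‖²_{L₂}, the swirl bound ‖r v_φ‖_{L_∞(ℝ³×(0,T))} ≤ ‖u(0)‖_{L_∞(ℝ³)}, and consequently ∫₀^T∫ |v_φ|⁴ dx dt ≤ c‖u(0)‖²_{L_∞}‖v(0)‖²_{L₂}. Fix r₀ > 0 and a smooth cut-off χ = χ(r) with χ(r) = 0 for r ≤ r₀ and χ(r) = 1 for r ≥ 2r₀, and set v̂_φ = v_φ χ, which satisfies v̂_{φ,t} + v·∇v̂_φ − ν∆v̂_φ + (v_r/r) v̂_φ + ν v̂_φ/r² = v·∇χ v_φ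 − 2ν∇v_φ·∇χ − ν v_φ ∆χ. Then there is a constant C, depending only on ν, χ, ‖v(0)‖_{L₂(ℝ³)} and ‖u(0)‖_{L_∞(ℝ³)}, such that ‖v̂_φ‖_{L_{20/3}(ℝ³×(0,T))} ≤ C. -/
open MeasureTheory Real Set ENNReal

noncomputable section

/-- A continuous function that is `0` far to the left and `1` far to the right is bounded. -/
theorem exists_abs_le_of_cutoff {χ : ℝ → ℝ} {a b : ℝ} (hχ : Continuous χ)
    (h0 : ∀ r ≤ a, χ r = 0) (h1 : ∀ r, b ≤ r → χ r = 1) :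
    ∃ M : ℝ, 0 ≤ M ∧ ∀ r, |χ r| ≤ M := by
  obtain ⟨M, hM⟩ := (isCompact_Icc (a := a) (b := b)).exists_bound_of_continuousOn hχ.continuousOn
  refine ⟨max M 1, le_max_of_le_right zero_le_one, fun r => ?_⟩
  rcases le_total r a with h | h
  · simp [h0 r h]
  rcases le_total b r with h' | h'
  · simp [h1 r h']
  · exact le_max_of_le_left (hM r ⟨h, h'⟩)

/-- Interpolation of a product between a bound on `v` and its fourth power. -/
theorem abs_mul_rpow_le_mul_pow_four {v y B M : ℝ} (hv : |v| ≤ B) (hy : |y| ≤ M) :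
    |v * y| ^ ((20 : ℝ) / 3) ≤ B ^ ((8 : ℝ) / 3) * M ^ ((20 : ℝ) / 3) * v ^ 4 := by
  have hB : 0 ≤ B := (abs_nonneg v).trans hv
  have hsplit : |v| ^ ((20 : ℝ) / 3) = |v| ^ ((8 : ℝ) / 3) * v ^ 4 := by
    rw [show ((20 : ℝ) / 3) = 8 / 3 + (4 : ℕ) by norm_num,
      Real.rpow_add_natCast' (abs_nonneg v) (by norm_num), (by decide : Even 4).pow_abs]
  rw [abs_mul, Real.mul_rpow (abs_nonneg v) (abs_nonneg y), hsplit]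
  calc |v| ^ ((8 : ℝ) / 3) * v ^ 4 * |y| ^ ((20 : ℝ) / 3)
      ≤ B ^ ((8 : ℝ) / 3) * v ^ 4 * M ^ ((20 : ℝ) / 3) := by gcongr
    _ = _ := by ring

/-- A pointwise bound on `(0, t)` by a constant multiple passes to space-time integrals. -/
theorem stIntegral_le_const_mul {t A : ℝ} {f g : ℝ → ℝ → ℝ → ℝ} (hA : 0 ≤ A)
    (h : ∀ r z, ∀ τ ∈ Set.Ioo 0 t, f r z τ ≤ A * g r z τ) :
    stIntegral t f ≤ ENNReal.ofReal A * stIntegral t g := by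
  unfold stIntegral
  rw [← lintegral_const_mul' _ _ ENNReal.ofReal_ne_top]
  refine setLIntegral_mono' measurableSet_Ioo fun τ hτ => ?_
  rw [← lintegral_const_mul' _ _ ENNReal.ofReal_ne_top]
  refine lintegral_mono fun x => ?_
  rw [← ENNReal.ofReal_mul hA]
  exact ENNReal.ofReal_le_ofReal (h _ _ τ hτ)

/-- **Estimate (3.16)**: away from the axis the cut-off angular component
`v̂_φ = v_φ χ` satisfies `‖v̂_φ‖_{L_{20/3}(ℝ³×(0,T))} ≤ C`, with `C` depending only on
`ν`, `χ`, `‖v(0)‖_{L₂(ℝ³)}` (bounded through `E`) and `‖u(0)‖_{L_∞(ℝ³)}` (bounded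
through `K`). -/
theorem cutoff_vphi_L20_3_bound
    (ν c r₀ E K : ℝ) (χ : ℝ → ℝ)
    (hν : 0 < ν) (hr₀ : 0 < r₀) (hE : 0 ≤ E) (hK : 0 ≤ K)
    -- the smooth cut-off function, vanishing for `r ≤ r₀` and equal to `1` for `r ≥ 2r₀`
    (hχ : ContDiff ℝ (⊤ : ℕ∞) χ) (hχ0 : ∀ r : ℝ, r ≤ r₀ → χ r = 0)
    (hχ1 : ∀ r : ℝ, 2 * r₀ ≤ r → χ r = 1) :
    ∃ C : ℝ, 0 < C ∧
      ∀ (T : ℝ) (vr vφ vz p : ℝ → ℝ → ℝ → ℝ),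
        0 < T →
        SmoothCyl vr → SmoothCyl vφ → SmoothCyl vz → SmoothCyl p →
        IsAxisymNS ν T vr vφ vz p →
        -- `‖v(0)‖²_{L₂(ℝ³)} ≤ E`
        spIntegral (fun r z => (vr r z 0) ^ 2 + (vφ r z 0) ^ 2 + (vz r z 0) ^ 2)
            ≤ ENNReal.ofReal E →
        -- the energy inequality
        (∀ t ∈ Set.Icc 0 T,
          spIntegral (fun r z => (vr r z t) ^ 2 + (vφ r z t) ^ 2 + (vz r z t) ^ 2)
            + ENNReal.ofReal ν * stIntegral t (fun r z τ =>
                (pdr vr r z τ) ^ 2 + (pdz vr r z τ) ^ 2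
                + (pdr vφ r z τ) ^ 2 + (pdz vφ r z τ) ^ 2
                + (pdr vz r z τ) ^ 2 + (pdz vz r z τ) ^ 2
                + (vr r z τ / r) ^ 2 + (vφ r z τ / r) ^ 2)
          ≤ ENNReal.ofReal c *
              spIntegral (fun r z => (vr r z 0) ^ 2 + (vφ r z 0) ^ 2 + (vz r z 0) ^ 2)) →
        -- the swirl bound `‖r v_φ‖_{L_∞(ℝ³×(0,T))} ≤ ‖u(0)‖_{L_∞(ℝ³)} ≤ K`
        (∀ r z t : ℝ, 0 < r → t ∈ Set.Icc 0 T → |r * vφ r z t| ≤ K) →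
        -- the consequent bound `∫₀ᵀ∫ |v_φ|⁴ dx dt ≤ c‖u(0)‖²_{L_∞}‖v(0)‖²_{L₂}`
        stIntegral T (fun r z t => (vφ r z t) ^ 4) ≤ ENNReal.ofReal (c * K ^ 2 * E) →
        (stIntegral T (fun r z t => |vφ r z t * χ r| ^ ((20:ℝ)/3))) ^ ((3:ℝ)/20)
          ≤ ENNReal.ofReal C := by
  obtain ⟨M, hM, hχM⟩ := exists_abs_le_of_cutoff hχ.continuous hχ0 hχ1
  set A : ℝ := (K / r₀) ^ ((8 : ℝ) / 3) * M ^ ((20 : ℝ) / 3)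
  have hA : 0 ≤ A := by positivity
  set D : ℝ≥0∞ :=
    (ENNReal.ofReal A * ENNReal.ofReal (c * K ^ 2 * E)) ^ ((3 : ℝ) / 20) with hDdef
  have hD : D ≠ ∞ := ENNReal.rpow_ne_top_of_nonneg (by norm_num)
    (ENNReal.mul_ne_top ENNReal.ofReal_ne_top ENNReal.ofReal_ne_top)
  refine ⟨D.toReal + 1, by positivity, ?_⟩
  intro T vr vφ vz p _ _ _ _ _ _ _ _ hswirl hL4
  have hpt : ∀ r z, ∀ t ∈ Set.Ioo 0 T,
      |vφ r z t * χ r| ^ ((20 : ℝ) / 3) ≤ A * vφ r z t ^ 4 := by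
    intro r z t ht
    rcases le_total r r₀ with hr | hr
    · rw [hχ0 r hr, mul_zero, abs_zero, Real.zero_rpow (by norm_num)]
      positivity
    · refine abs_mul_rpow_le_mul_pow_four ?_ (hχM r)
      have hrpos : 0 < r := hr₀.trans_le hr
      have hb := hswirl r z t hrpos ⟨ht.1.le, ht.2.le⟩
      rw [abs_mul, abs_of_pos hrpos] at hb
      rw [le_div_iff₀ hr₀, mul_comm]
      exact (mul_le_mul_of_nonneg_right hr (abs_nonneg _)).trans hb
  calc _ ≤ D := by
        rw [hDdef]
        gcongr
        exact (stIntegral_le_const_mul hA hpt).trans (by gcongr)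
    _ = ENNReal.ofReal D.toReal := (ENNReal.ofReal_toReal hD).symm
    _ ≤ _ := ENNReal.ofReal_le_ofReal (by linarith)
end
end
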